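/- arXiv:2507.18942 — 3 statements merged into one kernel-verified Lean document; each statement's English description precedes it below -/
import Mathlib

section
/- Assume in addition that for every τ ∈ ℝ the map y ↦ V(τ, y) is Fréchet differentiable and that the map (τ, y) ↦ D_yV(τ, y) is continuous on ℝ × ℝⁿ. Then any local flow map θ for V on I₀ is continuously differentiable (of class C¹) on the open set I₀ × I₀ × ℝⁿ. -/
/-- A *local flow map* for `V` on `I₀`: for every `(τ₀, x) ∈ I₀ × ℝⁿ`, the curve
`τ ↦ θ τ τ₀ x` is differentiable on `I₀`, satisfies `θ τ₀ τ₀ x = x`, and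
`∂θ/∂τ (τ, τ₀, x) = V (τ, θ τ τ₀ x)` for all `τ ∈ I₀`. -/
def IsLocalFlowMap {n : ℕ}
    (V : ℝ × EuclideanSpace ℝ (Fin n) → EuclideanSpace ℝ (Fin n))
    (I₀ : Set ℝ)
    (θ : ℝ → ℝ → EuclideanSpace ℝ (Fin n) → EuclideanSpace ℝ (Fin n)) : Prop :=
  ∀ τ₀ ∈ I₀, ∀ x : EuclideanSpace ℝ (Fin n),
    θ τ₀ τ₀ x = x ∧
    ∀ τ ∈ I₀, HasDerivAt (fun s => θ s τ₀ x) (V (τ, θ τ τ₀ x)) τ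

open Set Filter Topology

section ParametricODE

variable {X E F : Type*} [TopologicalSpace X] [NormedAddCommGroup E] [NormedSpace ℝ E]
  [NormedAddCommGroup F] [NormedSpace ℝ F]

/-- A two-sided Grönwall-type bound on an interval of length less than `1 / C`. -/
theorem norm_le_div_of_norm_deriv_le {u u' : ℝ → E} {C ε a b s t : ℝ} (hC : 0 ≤ C)
    (hlen : C * (b - a) < 1)
    (hu : ∀ r ∈ Icc a b, HasDerivWithinAt u (u' r) (Icc a b) r)
    (hbound : ∀ r ∈ Icc a b, ‖u' r‖ ≤ C * ‖u r‖ + ε) (hs : s ∈ Icc a b) (ht : t ∈ Icc a b) :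
    ‖u t‖ ≤ (‖u s‖ + ε * (b - a)) / (1 - C * (b - a)) := by
  have hcont : ContinuousOn u (Icc a b) := fun r hr => (hu r hr).continuousWithinAt
  obtain ⟨m, hm, hmax⟩ := isCompact_Icc.exists_isMaxOn ⟨s, hs⟩ hcont.norm
  have hmax' : ∀ r ∈ Icc a b, ‖u r‖ ≤ ‖u m‖ := fun r hr => hmax hr
  have hmv := (convex_Icc a b).norm_image_sub_le_of_norm_hasDerivWithin_le hu
    (C := C * ‖u m‖ + ε)
    (fun r hr => (hbound r hr).trans (by gcongr; exact hmax' r hr)) hs hm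
  have hnn : 0 ≤ C * ‖u m‖ + ε := (norm_nonneg _).trans (hbound m hm)
  have hms : ‖m - s‖ ≤ b - a := by
    rw [Real.norm_eq_abs, abs_le]
    constructor <;> linarith [hm.1, hm.2, hs.1, hs.2]
  have htri : ‖u m‖ ≤ ‖u m - u s‖ + ‖u s‖ := by
    simpa using norm_add_le (u m - u s) (u s)
  have hmul := mul_le_mul_of_nonneg_left hms hnn
  rw [le_div_iff₀ (by linarith)]
  have := mul_le_mul_of_nonneg_right (hmax' t ht) (by linarith : 0 ≤ 1 - C * (b - a))
  linarith

/-- Solutions of an ODE depending continuously on a parameter, with initial times and initial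
values depending continuously on the parameter, are jointly continuous. -/
theorem continuous_parametric_ode_solution {f : X → ℝ → E → E} {γ : X → ℝ → E} {t₀ : X → ℝ}
    {π : ℝ → ℝ} {C a b : ℝ} (hC : 0 ≤ C) (hlen : C * (b - a) < 1)
    (hf : Continuous fun p : X × ℝ × E => f p.1 p.2.1 p.2.2)
    (hlip : ∀ x t y z, ‖f x t y - f x t z‖ ≤ C * ‖y - z‖)
    (hγ : ∀ x, ∀ t ∈ Icc a b, HasDerivWithinAt (γ x) (f x t (γ x t)) (Icc a b) t)
    (ht₀ : Continuous t₀) (ht₀mem : ∀ x, t₀ x ∈ Icc a b)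
    (hinit : Continuous fun x => γ x (t₀ x))
    (hπ : Continuous π) (hπmem : ∀ t, π t ∈ Icc a b) (hπid : ∀ t ∈ Icc a b, π t = t) :
    Continuous fun p : X × ℝ => γ p.1 (π p.2) := by
  have hγπ (x : X) : Continuous fun t => γ x (π t) :=
    ContinuousOn.comp_continuous (s := Icc a b)
      (fun r hr => (hγ x r hr).continuousWithinAt) hπ hπmem
  have hpos : 0 < 1 - C * (b - a) := by linarith
  rw [continuous_iff_continuousAt]
  rintro ⟨x₀, s₀⟩
  have hab : a ≤ b := (ht₀mem x₀).1.trans (ht₀mem x₀).2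
  have hunif : ∀ δ > 0, ∀ᶠ x in 𝓝 x₀, ∀ t ∈ Icc a b, ‖γ x t - γ x₀ t‖ ≤ δ := by
    intro δ hδ
    obtain ⟨ε, hε, hεδ⟩ : ∃ ε > 0, (ε + ε * (b - a)) / (1 - C * (b - a)) ≤ δ := by
      refine ⟨δ * (1 - C * (b - a)) / (1 + (b - a)), by
        apply div_pos (by positivity); linarith, le_of_eq ?_⟩
      have : 1 + (b - a) ≠ 0 := by linarith
      field_simp
    have hfield : ∀ᶠ x in 𝓝 x₀, ∀ t ∈ Icc a b,
        ‖f x t (γ x₀ (π t)) - f x₀ t (γ x₀ (π t))‖ < ε := by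
      apply isCompact_Icc.eventually_forall_of_forall_eventually
      intro t _
      have hc : Continuous fun z : X × ℝ =>
          ‖f z.1 z.2 (γ x₀ (π z.2)) - f x₀ z.2 (γ x₀ (π z.2))‖ := by
        have h1 : Continuous fun z : X × ℝ => γ x₀ (π z.2) := (hγπ x₀).comp continuous_snd
        exact ((hf.comp (continuous_fst.prodMk (continuous_snd.prodMk h1))).sub
          (hf.comp ((continuous_const (y := x₀)).prodMk (continuous_snd.prodMk h1)))).norm
      exact hc.continuousAt.eventually_lt continuousAt_const (by simpa using hε)
    have hstart : ∀ᶠ x in 𝓝 x₀, ‖γ x (t₀ x) - γ x₀ (t₀ x)‖ < ε := by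
      have hc : Continuous fun x => ‖γ x (t₀ x) - γ x₀ (t₀ x)‖ := by
        have h1 := (hγπ x₀).comp ht₀
        have h2 : (fun t => γ x₀ (π t)) ∘ t₀ = fun x => γ x₀ (t₀ x) := by
          funext x; simp [hπid _ (ht₀mem x)]
        rw [h2] at h1
        exact (hinit.sub h1).norm
      exact hc.continuousAt.eventually_lt continuousAt_const (by simpa using hε)
    filter_upwards [hfield, hstart] with x hx hx' t ht
    refine le_trans (norm_le_div_of_norm_deriv_le (ε := ε) hC hlen
      (fun r hr => (hγ x r hr).sub (hγ x₀ r hr)) (fun r hr => ?_) (ht₀mem x) ht) (le_trans ?_ hεδ)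
    · have h1 := hlip x r (γ x r) (γ x₀ r)
      have h2 := hx r hr
      rw [hπid r hr] at h2
      have h3 := norm_sub_le_norm_sub_add_norm_sub (f x r (γ x r)) (f x r (γ x₀ r))
        (f x₀ r (γ x₀ r))
      simp only [Pi.sub_apply]
      linarith
    · simp only [Pi.sub_apply]
      gcongr
  rw [Metric.continuousAt_iff']
  intro δ hδ
  have h1 := (continuous_fst.continuousAt (x := (x₀, s₀))).eventually
    (hunif (δ / 2) (by positivity))
  have h2 : ∀ᶠ p : X × ℝ in 𝓝 (x₀, s₀), dist (γ x₀ (π p.2)) (γ x₀ (π s₀)) < δ / 2 :=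
    Metric.continuousAt_iff'.1 ((hγπ x₀).comp continuous_snd).continuousAt _ (by positivity)
  filter_upwards [h1, h2] with p hp hp'
  have h3 := hp (π p.2) (hπmem _)
  rw [← dist_eq_norm] at h3
  linarith [dist_triangle (γ p.1 (π p.2)) (γ x₀ (π p.2)) (γ x₀ (π s₀))]

/-- The fundamental solution of a linear ODE on a short interval exists. -/
theorem exists_linear_ode_fundamental_solution [CompleteSpace E] {B : ℝ → E →L[ℝ] E}
    {C a b t₀ : ℝ} (hC : 0 ≤ C) (hlen : C * (b - a) < 1) (hB : Continuous B)
    (hBC : ∀ t, ‖B t‖ ≤ C) (ht₀ : t₀ ∈ Icc a b) :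
    ∃ M : ℝ → E →L[ℝ] E, M t₀ = ContinuousLinearMap.id ℝ E ∧
      ∀ t ∈ Icc a b, HasDerivWithinAt M (B t ∘L M t) (Icc a b) t := by
  have hpos : 0 < 1 - C * (b - a) := by linarith
  have hab : a ≤ b := ht₀.1.trans ht₀.2
  have hab' : 0 ≤ b - a := by linarith
  set N : ℝ := ‖ContinuousLinearMap.id ℝ E‖ with hN
  have hN0 : 0 ≤ N := norm_nonneg _
  set R : ℝ := C * (b - a) * N / (1 - C * (b - a)) with hR
  have hR0 : 0 ≤ R := by positivity
  have hpl : IsPicardLindelof (fun t (A : E →L[ℝ] E) => B t ∘L A) (⟨t₀, ht₀⟩ : Icc a b)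
      (ContinuousLinearMap.id ℝ E) ⟨R, hR0⟩ 0 ⟨C * (N + R), by positivity⟩ ⟨C, hC⟩ := by
    refine ⟨fun t _ => ?_, fun A _ => by fun_prop, fun t _ A hA => ?_, ?_⟩
    · refine LipschitzWith.lipschitzOnWith (LipschitzWith.of_dist_le_mul fun A A' => ?_)
      rw [dist_eq_norm, dist_eq_norm, ← ContinuousLinearMap.comp_sub]
      refine (ContinuousLinearMap.opNorm_comp_le _ _).trans ?_
      exact mul_le_mul_of_nonneg_right (hBC t) (norm_nonneg _)
    · refine (ContinuousLinearMap.opNorm_comp_le _ _).trans ?_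
      have h1 : ‖A - ContinuousLinearMap.id ℝ E‖ ≤ R := by
        rwa [mem_closedBall_iff_norm] at hA
      have h2 : ‖A‖ ≤ N + R := by
        have := norm_add_le (A - ContinuousLinearMap.id ℝ E) (ContinuousLinearMap.id ℝ E)
        rw [sub_add_cancel] at this
        linarith
      exact mul_le_mul (hBC t) h2 (norm_nonneg _) hC
    · have h1 : max (b - t₀) (t₀ - a) ≤ b - a :=
        max_le (by linarith [ht₀.1]) (by linarith [ht₀.2])
      have h2 : C * (N + R) * (b - a) = R := by
        rw [hR]; field_simp; ring
      have h3 := mul_le_mul_of_nonneg_left h1 (by positivity : 0 ≤ C * (N + R))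
      show C * (N + R) * max (b - t₀) (t₀ - a) ≤ R - 0
      linarith
  exact hpl.exists_eq_forall_mem_Icc_hasDerivWithinAt₀

/-- A function whose increments factor through a continuous family of linear maps is `C¹`. -/
theorem contDiffOn_one_of_sub_eq_apply {f : E → F} {s : Set E} (hs : IsOpen s)
    {L : E → E → E →L[ℝ] F} (hL : Continuous fun p : E × E => L p.1 p.2)
    (hf : ∀ p ∈ s, ∀ q ∈ s, f q - f p = L p q (q - p)) : ContDiffOn ℝ 1 f s := by
  have hderiv : ∀ p ∈ s, HasFDerivAt f (L p p) p := by
    intro p hp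
    rw [hasFDerivAt_iff_isLittleO, Asymptotics.isLittleO_iff]
    intro c hc
    have h1 : ∀ᶠ q in 𝓝 p, ‖L p q - L p p‖ < c :=
      (ContinuousAt.norm (by fun_prop)).eventually_lt continuousAt_const (by simpa using hc)
    filter_upwards [h1, hs.mem_nhds hp] with q hq hqs
    rw [hf p hp q hqs, ← _root_.sub_apply]
    exact (ContinuousLinearMap.le_opNorm _ _).trans (by gcongr)
  rw [show (1 : WithTop ℕ∞) = 0 + 1 from rfl,
    contDiffOn_succ_iff_hasFDerivWithinAt_of_uniqueDiffOn hs.uniqueDiffOn]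
  refine ⟨by simp, fun p => L p p, ?_, fun p hp => (hderiv p hp).hasFDerivWithinAt⟩
  rw [contDiffOn_zero]
  fun_prop

/-- Hadamard's lemma with parameters. -/
theorem exists_continuous_sub_eq_apply [CompleteSpace E] {V : ℝ × E → E} {C : ℝ}
    (hdiff : ∀ t, Differentiable ℝ fun y => V (t, y))
    (hDV : Continuous fun p : ℝ × E => fderiv ℝ (fun y => V (p.1, y)) p.2)
    (hDVC : ∀ p : ℝ × E, ‖fderiv ℝ (fun y => V (p.1, y)) p.2‖ ≤ C) :
    ∃ G : ℝ → E → E → E →L[ℝ] E, (Continuous fun p : ℝ × E × E => G p.1 p.2.1 p.2.2) ∧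
      (∀ t y z, ‖G t y z‖ ≤ C) ∧ ∀ t y z, V (t, z) - V (t, y) = G t y z (z - y) := by
  have hc : Continuous fun q : (ℝ × E × E) × ℝ =>
      fderiv ℝ (fun w => V (q.1.1, w)) (q.1.2.1 + q.2 • (q.1.2.2 - q.1.2.1)) :=
    hDV.comp (g := fun p : ℝ × E => fderiv ℝ (fun y => V (p.1, y)) p.2)
      (f := fun q : (ℝ × E × E) × ℝ => (q.1.1, q.1.2.1 + q.2 • (q.1.2.2 - q.1.2.1)))
      (by fun_prop)
  refine ⟨fun t y z => ∫ r in (0 : ℝ)..1, fderiv ℝ (fun w => V (t, w)) (y + r • (z - y)),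
    ?_, fun t y z => ?_, fun t y z => ?_⟩
  · exact intervalIntegral.continuous_parametric_intervalIntegral_of_continuous' hc 0 1
  · simpa using intervalIntegral.norm_integral_le_of_norm_le_const (a := (0 : ℝ)) (b := 1)
      (f := fun r => fderiv ℝ (fun w => V (t, w)) (y + r • (z - y)))
      fun r _ => hDVC (t, y + r • (z - y))
  · have hcr : Continuous fun r : ℝ => fderiv ℝ (fun w => V (t, w)) (y + r • (z - y)) :=
      hc.comp (g := fun q : (ℝ × E × E) × ℝ =>
        fderiv ℝ (fun w => V (q.1.1, w)) (q.1.2.1 + q.2 • (q.1.2.2 - q.1.2.1)))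
        (f := fun r : ℝ => ((t, y, z), r)) (by fun_prop)
    rw [ContinuousLinearMap.intervalIntegral_apply (hcr.intervalIntegrable _ _)]
    have hline (r : ℝ) : HasDerivAt (fun r : ℝ => y + r • (z - y)) (z - y) r := by
      simpa using ((hasDerivAt_id r).smul_const (z - y)).const_add y
    have hd (r : ℝ) : HasDerivAt (fun r : ℝ => V (t, y + r • (z - y)))
        (fderiv ℝ (fun w => V (t, w)) (y + r • (z - y)) (z - y)) r :=
      HasFDerivAt.comp_hasDerivAt (l := fun w => V (t, w)) r
        (hdiff t (y + r • (z - y))).hasFDerivAt (hline r)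
    rw [intervalIntegral.integral_eq_sub_of_hasDerivAt (fun r _ => hd r)
      ((hcr.clm_apply continuous_const).intervalIntegrable _ _)]
    simp

/-- A flow on a short compact interval of a vector field that is `C¹` in space is `C¹` on the
interior of the interval, jointly in all variables. -/
theorem contDiffOn_flow_of_Icc [CompleteSpace E] {V : ℝ × E → E} {C a b : ℝ} (hC : 0 ≤ C)
    (hab : a ≤ b) (hlen : C * (b - a) < 1) (hV : Continuous V)
    (hlip : ∀ t y z, ‖V (t, y) - V (t, z)‖ ≤ C * ‖y - z‖)
    (hdiff : ∀ t, Differentiable ℝ fun y => V (t, y))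
    (hDV : Continuous fun p : ℝ × E => fderiv ℝ (fun y => V (p.1, y)) p.2)
    {θ : ℝ → ℝ → E → E} (hθinit : ∀ σ ∈ Icc a b, ∀ x, θ σ σ x = x)
    (hθ : ∀ σ ∈ Icc a b, ∀ x, ∀ t ∈ Icc a b,
      HasDerivAt (fun s => θ s σ x) (V (t, θ t σ x)) t) :
    ContDiffOn ℝ 1 (fun p : ℝ × ℝ × E => θ p.1 p.2.1 p.2.2)
      (Ioo a b ×ˢ Ioo a b ×ˢ (univ : Set E)) := by
  obtain ⟨π, hπ, hπmem, hπid⟩ : ∃ π : ℝ → ℝ, Continuous π ∧ (∀ t, π t ∈ Icc a b) ∧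
      ∀ t ∈ Icc a b, π t = t :=
    ⟨fun t => projIcc a b hab t, by fun_prop, fun t => (projIcc a b hab t).2,
      fun t ht => by simp [projIcc_of_mem hab ht]⟩
  have hDVC : ∀ p : ℝ × E, ‖fderiv ℝ (fun y => V (p.1, y)) p.2‖ ≤ C := fun p =>
    norm_fderiv_le_of_lip' ℝ hC (Eventually.of_forall fun y => hlip p.1 y p.2)
  obtain ⟨G, hG, hGC, hGV⟩ := exists_continuous_sub_eq_apply hdiff hDV hDVC
  have hflow : Continuous fun p : (ℝ × E) × ℝ => θ (π p.2) (π p.1.1) p.1.2 :=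
    continuous_parametric_ode_solution (f := fun (_ : ℝ × E) t y => V (t, y))
      (γ := fun p t => θ t (π p.1) p.2) (t₀ := fun p => π p.1) hC hlen (by fun_prop)
      (fun _ => hlip) (fun p t ht => (hθ _ (hπmem _) _ t ht).hasDerivWithinAt) (by fun_prop)
      (fun _ => hπmem _) (by simpa only [hθinit _ (hπmem _)] using continuous_snd)
      hπ hπmem hπid
  have hflow' {Y : Type _} [TopologicalSpace Y] {g h : Y → ℝ} {k : Y → E} (hg : Continuous g)
      (hh : Continuous h) (hk : Continuous k) :
      Continuous fun y => θ (π (g y)) (π (h y)) (k y) :=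
    hflow.comp ((hh.prodMk hk).prodMk hg)
  -- the parameters are a pair of initial conditions `(σ, x)`, `(σ', x')`
  set B : (ℝ × E) × (ℝ × E) → ℝ → E →L[ℝ] E := fun P t =>
    G t (θ (π t) (π P.1.1) P.1.2) (θ (π t) (π P.2.1) P.2.2) with hBdef
  have hB : Continuous fun p : ((ℝ × E) × (ℝ × E)) × ℝ => B p.1 p.2 :=
    hG.comp (continuous_snd.prodMk
      ((hflow' continuous_snd (by fun_prop) (by fun_prop)).prodMk
        (hflow' continuous_snd (by fun_prop) (by fun_prop))))
  choose M hMinit hM using fun P : (ℝ × E) × (ℝ × E) =>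
    exists_linear_ode_fundamental_solution (B := B P) hC hlen (by fun_prop)
      (fun t => hGC _ _ _) (hπmem P.1.1)
  have hMcont : Continuous fun p : ((ℝ × E) × (ℝ × E)) × ℝ => M p.1 (π p.2) :=
    continuous_parametric_ode_solution (f := fun P t (A : E →L[ℝ] E) => B P t ∘L A)
      (t₀ := fun P => π P.1.1) hC hlen
      (by
        have h1 : Continuous fun p : ((ℝ × E) × (ℝ × E)) × ℝ × (E →L[ℝ] E) => B p.1 p.2.1 :=
          hB.comp (continuous_fst.prodMk (continuous_fst.comp continuous_snd))
        exact h1.clm_comp (by fun_prop))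
      (fun P t A A' => by
        rw [← ContinuousLinearMap.comp_sub]
        exact (ContinuousLinearMap.opNorm_comp_le _ _).trans
          (mul_le_mul_of_nonneg_right (hGC _ _ _) (norm_nonneg _)))
      hM (by fun_prop) (fun _ => hπmem _) (by simpa only [hMinit] using continuous_const)
      hπ hπmem hπid
  have hMsub : ∀ P : (ℝ × E) × (ℝ × E), P.1.1 ∈ Icc a b → P.2.1 ∈ Icc a b → ∀ t ∈ Icc a b,
      θ t P.2.1 P.2.2 - θ t P.1.1 P.1.2 = M P t (θ P.1.1 P.2.1 P.2.2 - P.1.2) := by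
    intro P h1 h2 t ht
    set v := θ P.1.1 P.2.1 P.2.2 - P.1.2 with hv
    have hu : ∀ r ∈ Icc a b, HasDerivWithinAt
        (fun r => θ r P.2.1 P.2.2 - θ r P.1.1 P.1.2 - M P r v)
        (B P r (θ r P.2.1 P.2.2 - θ r P.1.1 P.1.2 - M P r v)) (Icc a b) r := by
      intro r hr
      have hd := ((hθ _ h2 P.2.2 r hr).hasDerivWithinAt.sub
        (hθ _ h1 P.1.2 r hr).hasDerivWithinAt).sub
        ((hM P r hr).clm_apply (hasDerivWithinAt_const r (Icc a b) v))
      refine hd.congr_deriv ?_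
      rw [hGV, map_sub, hBdef]
      simp [hπid _ hr, hπid _ h1, hπid _ h2]
    have hzero := norm_le_div_of_norm_deriv_le (ε := 0) hC hlen hu
      (fun r _ => by
        rw [add_zero]
        exact ((B P r).le_opNorm _).trans
          (mul_le_mul_of_nonneg_right (hGC _ _ _) (norm_nonneg _))) h1 ht
    have h3 : M P P.1.1 = ContinuousLinearMap.id ℝ E := by
      rw [← hMinit P, hπid _ h1]
    have h4 : θ P.1.1 P.2.1 P.2.2 - θ P.1.1 P.1.1 P.1.2 - M P P.1.1 v = 0 := by
      rw [h3, hθinit _ h1, hv]; simp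
    simp only [h4, norm_zero, zero_mul, add_zero, zero_div, norm_le_zero_iff] at hzero
    exact sub_eq_zero.1 hzero
  set Φ : (ℝ × E) × ℝ × ℝ → E := fun q => ∫ r in (0 : ℝ)..1,
    V (q.2.1 + r * (q.2.2 - q.2.1), θ (π (q.2.1 + r * (q.2.2 - q.2.1))) (π q.1.1) q.1.2)
    with hΦdef
  have hΦ : Continuous Φ :=
    intervalIntegral.continuous_parametric_intervalIntegral_of_continuous'
      (f := fun (q : (ℝ × E) × ℝ × ℝ) r => V (q.2.1 + r * (q.2.2 - q.2.1),
        θ (π (q.2.1 + r * (q.2.2 - q.2.1))) (π q.1.1) q.1.2))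
      (hV.comp ((by fun_prop :
          Continuous fun p : ((ℝ × E) × ℝ × ℝ) × ℝ => p.1.2.1 + p.2 * (p.1.2.2 - p.1.2.1)).prodMk
        (hflow' (by fun_prop) (by fun_prop) (by fun_prop)))) 0 1
  have hΦsub : ∀ σ ∈ Icc a b, ∀ x, ∀ s ∈ Icc a b, ∀ t ∈ Icc a b,
      θ t σ x - θ s σ x = (t - s) • Φ ((σ, x), s, t) := by
    intro σ hσ x s hs t ht
    have hmem : ∀ r ∈ uIcc (0 : ℝ) 1, s + r * (t - s) ∈ Icc a b := by
      intro r hr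
      rw [uIcc_of_le zero_le_one] at hr
      exact (convex_Icc a b).add_smul_sub_mem hs ht hr
    have hline (r : ℝ) : HasDerivAt (fun r : ℝ => s + r * (t - s)) (t - s) r := by
      simpa using ((hasDerivAt_id r).mul_const (t - s)).const_add s
    have hd : ∀ r ∈ uIcc (0 : ℝ) 1, HasDerivAt (fun r => θ (s + r * (t - s)) σ x)
        ((t - s) • V (s + r * (t - s), θ (π (s + r * (t - s))) (π σ) x)) r := by
      intro r hr
      rw [hπid _ hσ, hπid _ (hmem r hr)]
      exact (hθ σ hσ x _ (hmem r hr)).scomp r (hline r)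
    have hint := intervalIntegral.integral_eq_sub_of_hasDerivAt hd
      (Continuous.intervalIntegrable
        ((hV.comp ((by fun_prop : Continuous fun r : ℝ => s + r * (t - s)).prodMk
          (hflow.comp ((continuous_const (y := (σ, x))).prodMk
            (by fun_prop : Continuous fun r : ℝ => s + r * (t - s)))))).const_smul (t - s)) _ _)
    rw [intervalIntegral.integral_smul] at hint
    simpa using hint.symm
  set L : ℝ × ℝ × E → ℝ × ℝ × E → (ℝ × ℝ × E →L[ℝ] E) := fun p q =>
    (ContinuousLinearMap.fst ℝ ℝ (ℝ × E)).smulRight (Φ (q.2, p.1, q.1)) +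
      M (p.2, q.2) (π p.1) ∘L
        (ContinuousLinearMap.snd ℝ ℝ E ∘L ContinuousLinearMap.snd ℝ ℝ (ℝ × E) -
          (ContinuousLinearMap.fst ℝ ℝ E ∘L
            ContinuousLinearMap.snd ℝ ℝ (ℝ × E)).smulRight (Φ (q.2, q.2.1, p.2.1))) with hLdef
  have hsmulRight (ℓ : ℝ × ℝ × E →L[ℝ] ℝ) : Continuous fun y : E => ℓ.smulRight y :=
    (ContinuousLinearMap.smulRightL ℝ (ℝ × ℝ × E) E ℓ).continuous
  have hL : Continuous fun p : (ℝ × ℝ × E) × (ℝ × ℝ × E) => L p.1 p.2 := by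
    refine ((hsmulRight _).comp (hΦ.comp (by fun_prop))).add (Continuous.clm_comp ?_
      (continuous_const.sub ((hsmulRight _).comp (hΦ.comp (by fun_prop)))))
    exact hMcont.comp (f := fun p : (ℝ × ℝ × E) × (ℝ × ℝ × E) => ((p.1.2, p.2.2), p.1.1))
      (by fun_prop)
  refine contDiffOn_one_of_sub_eq_apply
    (isOpen_Ioo.prod (isOpen_Ioo.prod isOpen_univ)) hL ?_
  rintro ⟨τ, σ, x⟩ ⟨hτ, hσ, -⟩ ⟨τ', σ', x'⟩ ⟨hτ', hσ', -⟩
  replace hτ := Ioo_subset_Icc_self hτ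
  replace hσ := Ioo_subset_Icc_self hσ
  replace hτ' := Ioo_subset_Icc_self hτ'
  replace hσ' := Ioo_subset_Icc_self hσ'
  dsimp only at hτ hσ hτ' hσ'
  have h1 := hΦsub σ' hσ' x' τ hτ τ' hτ'
  have h2 := hMsub ((σ, x), (σ', x')) hσ hσ' τ hτ
  have h3 := hΦsub σ' hσ' x' σ' hσ' σ hσ
  rw [hθinit _ hσ', sub_eq_iff_eq_add] at h3
  dsimp only at h2
  rw [h3] at h2
  have h4 : (σ - σ') • Φ ((σ', x'), σ', σ) + x' - x =
      x' - x - (σ' - σ) • Φ ((σ', x'), σ', σ) := by module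
  rw [h4] at h2
  have h5 : θ τ' σ' x' - θ τ σ x = (θ τ' σ' x' - θ τ σ' x') + (θ τ σ' x' - θ τ σ x) := by abel
  dsimp only
  rw [h5, h1, h2, hLdef]
  simp [hπid _ hτ]

end ParametricODE

/-- **C¹ regularity of the local flow map.**
Let `V : ℝ × ℝⁿ → ℝⁿ` be continuous and bounded, uniformly Lipschitz in the second variable
with constant `C > 0`. Assume moreover that for every `τ` the map `y ↦ V (τ, y)` is Fréchet
differentiable and that `(τ, y) ↦ D_y V (τ, y)` is continuous on `ℝ × ℝⁿ`. Let
`I₀ = Ioo a b` be an open interval of length less than `1/C`. Then any local flow map `θ`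
for `V` on `I₀` is continuously differentiable on the open set `I₀ × I₀ × ℝⁿ`. -/
theorem stmt_3 {n : ℕ} (hn : 1 ≤ n)
    (V : ℝ × EuclideanSpace ℝ (Fin n) → EuclideanSpace ℝ (Fin n))
    (C : ℝ) (hC : 0 < C)
    (hVcont : Continuous V)
    (hVbdd : ∃ M : ℝ, ∀ p, ‖V p‖ ≤ M)
    (hVlip : ∀ (τ : ℝ) (y₁ y₂ : EuclideanSpace ℝ (Fin n)),
      ‖V (τ, y₁) - V (τ, y₂)‖ ≤ C * ‖y₁ - y₂‖)
    (hVdiff : ∀ τ : ℝ, Differentiable ℝ (fun y => V (τ, y)))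
    (hDVcont : Continuous (fun p : ℝ × EuclideanSpace ℝ (Fin n) =>
      fderiv ℝ (fun y => V (p.1, y)) p.2))
    (a b : ℝ) (hab : a < b) (hlen : b - a < 1 / C)
    (θ : ℝ → ℝ → EuclideanSpace ℝ (Fin n) → EuclideanSpace ℝ (Fin n))
    (hθ : IsLocalFlowMap V (Set.Ioo a b) θ) :
    ContDiffOn ℝ 1 (fun p : ℝ × ℝ × EuclideanSpace ℝ (Fin n) => θ p.1 p.2.1 p.2.2)
      (Set.Ioo a b ×ˢ Set.Ioo a b ×ˢ (Set.univ : Set (EuclideanSpace ℝ (Fin n)))) := by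
  rintro ⟨τ, σ, x⟩ ⟨hτ, hσ, -⟩
  dsimp only at hτ hσ
  obtain ⟨a', ha, ha'⟩ := exists_between (lt_min hτ.1 hσ.1)
  obtain ⟨b', hb', hb⟩ := exists_between (max_lt hτ.2 hσ.2)
  rw [lt_min_iff] at ha'
  rw [max_lt_iff] at hb'
  have hsub : Set.Icc a' b' ⊆ Set.Ioo a b := Set.Icc_subset_Ioo ha hb
  have hlen' : C * (b' - a') < 1 := by
    rw [lt_div_iff₀ hC] at hlen
    nlinarith
  have h := contDiffOn_flow_of_Icc hC.le (by linarith) hlen' hVcont hVlip hVdiff hDVcont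
    (fun s hs y => (hθ s (hsub hs) y).1)
    (fun s hs y t ht => (hθ s (hsub hs) y).2 t (hsub ht))
  refine (h.contDiffAt ?_).contDiffWithinAt
  exact (isOpen_Ioo.prod (isOpen_Ioo.prod isOpen_univ)).mem_nhds
    ⟨⟨ha'.1, hb'.1⟩, ⟨ha'.2, hb'.2⟩, Set.mem_univ _⟩
end

section
/- Let k ≥ 1 and assume in addition that for each 1 ≤ j ≤ k and every τ ∈ ℝ the j-th Fréchet derivative of y ↦ V(τ, y) exists and the map (τ, y) ↦ D_y^j V(τ, y) is continuous on ℝ × ℝⁿ. Then for any local flow map θ for V on I₀ and any fixed τ, τ₀ ∈ I₀, the map x ↦ θ(τ, τ₀, x) from ℝⁿ to ℝⁿ is k times continuously differentiable (of class Cᵏ). -/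
section Nemytskii

universe u

variable {K : Type*} [TopologicalSpace K]
  {E F : Type u} [NormedAddCommGroup E] [NormedAddCommGroup F]

/-- The superposition operator `γ ↦ (t ↦ f (t, γ t))` on continuous curves. -/
def nemytskii (f : C(K × E, F)) (γ : C(K, E)) : C(K, F) :=
  f.comp ((ContinuousMap.id K).prodMk γ)

@[simp]
theorem nemytskii_apply (f : C(K × E, F)) (γ : C(K, E)) (t : K) :
    nemytskii f γ t = f (t, γ t) := rfl

variable [CompactSpace K]

theorem continuous_nemytskii (f : C(K × E, F)) : Continuous (nemytskii f) := by
  have h : Continuous fun γ : C(K, E) => (ContinuousMap.id K).prodMk γ :=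
    ContinuousMap.continuous_of_continuous_uncurry _ (by
      simp only [Function.uncurry_def, ContinuousMap.prod_eval, ContinuousMap.id_apply]
      fun_prop)
  exact (ContinuousMap.continuous_postcomp f).comp h

variable [NormedSpace ℝ E] [NormedSpace ℝ F]

variable (K E F) in
/-- The pointwise application of a continuous family of operators to a continuous curve. -/
noncomputable def pointwiseApply : C(K, E →L[ℝ] F) →L[ℝ] C(K, E) →L[ℝ] C(K, F) :=
  LinearMap.mkContinuous₂
    (LinearMap.mk₂ ℝ
      (fun (A : C(K, E →L[ℝ] F)) (γ : C(K, E)) =>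
        (⟨fun t => A t (γ t), A.continuous.clm_apply γ.continuous⟩ : C(K, F)))
      (fun _ _ _ => by ext; simp) (fun _ _ _ => by ext; simp)
      (fun _ _ _ => by ext; simp) (fun _ _ _ => by ext; simp))
    1 fun A γ => by
      rw [one_mul]
      refine (ContinuousMap.norm_le _ (by positivity)).2 fun t => ?_
      exact (A t).le_of_opNorm_le_of_le (A.norm_coe_le_norm t) (γ.norm_coe_le_norm t)

theorem norm_pointwiseApply_le (A : C(K, E →L[ℝ] F)) {c : ℝ} (hc : 0 ≤ c)
    (hA : ∀ t, ‖A t‖ ≤ c) : ‖pointwiseApply K E F A‖ ≤ c := by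
  refine ContinuousLinearMap.opNorm_le_bound _ hc fun γ => ?_
  refine (ContinuousMap.norm_le _ (by positivity)).2 fun t => ?_
  exact (A t).le_of_opNorm_le_of_le (hA t) (γ.norm_coe_le_norm t)

theorem hasFDerivAt_nemytskii (f : C(K × E, F)) (f' : C(K × E, E →L[ℝ] F))
    (hf : ∀ t y, HasFDerivAt (fun z => f (t, z)) (f' (t, y)) y) (γ : C(K, E)) :
    HasFDerivAt (nemytskii f) (pointwiseApply K E F (nemytskii f' γ)) γ := by
  rw [hasFDerivAt_iff_isLittleO_nhds_zero, Asymptotics.isLittleO_iff]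
  intro ε hε
  obtain ⟨δ, hδ, hclose⟩ :=
    Metric.continuous_iff.1 (continuous_nemytskii f') γ ε hε
  filter_upwards [Metric.ball_mem_nhds (0 : C(K, E)) hδ] with h hh
  rw [mem_ball_zero_iff] at hh
  refine (ContinuousMap.norm_le _ (by positivity)).2 fun t => ?_
  have hbound : ∀ y ∈ Metric.ball (γ t) δ, ‖f' (t, y) - f' (t, γ t)‖ ≤ ε := by
    intro y hy
    have hdist : dist (γ + ContinuousMap.const K (y - γ t)) γ < δ := by
      rw [dist_eq_norm, add_sub_cancel_left]
      refine (ContinuousMap.norm_lt_iff _ hδ).2 fun s => ?_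
      simpa [dist_eq_norm] using hy
    have := (ContinuousMap.dist_apply_le_dist t).trans (hclose _ hdist).le
    simpa [dist_eq_norm] using this
  have hmem : γ t + h t ∈ Metric.ball (γ t) δ := by
    simpa using (h.norm_coe_le_norm t).trans_lt hh
  have key := (convex_ball (γ t) δ).norm_image_sub_le_of_norm_hasFDerivWithin_le'
    (fun y _ => (hf t y).hasFDerivWithinAt) hbound (Metric.mem_ball_self hδ) hmem
  rw [add_sub_cancel_left] at key
  exact key.trans (by gcongr; exact h.norm_coe_le_norm t)

theorem continuous_fderiv_snd {X : Type*} [TopologicalSpace X] {f : X × E → F}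
    (h : Continuous fun p : X × E => iteratedFDeriv ℝ 1 (fun y => f (p.1, y)) p.2) :
    Continuous fun p : X × E => fderiv ℝ (fun y => f (p.1, y)) p.2 := by
  have : (fun p : X × E => fderiv ℝ (fun y => f (p.1, y)) p.2) = fun p =>
      (continuousMultilinearCurryFin1 ℝ E F) (iteratedFDeriv ℝ 1 (fun y => f (p.1, y)) p.2) := by
    ext p v
    simp [iteratedFDeriv_one_apply]
  rw [this]
  exact (continuousMultilinearCurryFin1 ℝ E F).continuous.comp h

theorem contDiff_nemytskii (k : ℕ) (f : C(K × E, F))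
    (hf : ∀ t, ContDiff ℝ k fun y => f (t, y))
    (hc : ∀ j, 1 ≤ j → j ≤ k →
      Continuous fun p : K × E => iteratedFDeriv ℝ j (fun y => f (p.1, y)) p.2) :
    ContDiff ℝ k (nemytskii f) := by
  induction k generalizing F with
  | zero => exact contDiff_zero.2 (continuous_nemytskii f)
  | succ k ih =>
    let f' : C(K × E, E →L[ℝ] F) :=
      ⟨fun p => fderiv ℝ (fun y => f (p.1, y)) p.2,
        continuous_fderiv_snd (hc 1 le_rfl (by omega))⟩
    have hf' : ∀ t y, HasFDerivAt (fun z => f (t, z)) (f' (t, y)) y := fun t y =>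
      ((hf t).differentiable (by simp) y).hasFDerivAt
    push_cast at hf ⊢
    refine contDiff_succ_iff_hasFDerivAt.2
      ⟨_, ?_, fun γ => hasFDerivAt_nemytskii f f' hf' γ⟩
    refine (pointwiseApply K E F).contDiff.comp (ih f' (fun t => ?_) fun j hj hjk => ?_)
    · exact (contDiff_succ_iff_fderiv.1 (hf t)).2.2
    · have := hc (j + 1) (by omega) (by omega)
      simp only [iteratedFDeriv_succ_eq_comp_right, Function.comp_apply] at this
      exact (LinearIsometryEquiv.comp_continuous_iff _).1 this

end Nemytskii

section IntegralOperator

open MeasureTheory Set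

variable {E : Type*} [NormedAddCommGroup E] [NormedSpace ℝ E]

/-- The operator `u ↦ (s ↦ ∫ σ in t₀..s, u σ)` on continuous curves over `[c, d]`. -/
noncomputable def integralOperator {c d : ℝ} (hcd : c ≤ d) (t₀ : Icc c d) :
    C(Icc c d, E) →L[ℝ] C(Icc c d, E) :=
  LinearMap.mkContinuous
    { toFun := fun u => ⟨fun s => ∫ σ in (t₀ : ℝ)..s, IccExtend hcd u σ,
        (intervalIntegral.continuous_primitive
          (fun _ _ => u.continuous.Icc_extend'.intervalIntegrable _ _) _).comp
          continuous_subtype_val⟩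
      map_add' := fun u v => by
        ext s
        exact intervalIntegral.integral_add (u.continuous.Icc_extend'.intervalIntegrable _ _)
          (v.continuous.Icc_extend'.intervalIntegrable _ _)
      map_smul' := fun r u => by
        ext s
        exact intervalIntegral.integral_smul r _ }
    (d - c) fun u => by
      refine (ContinuousMap.norm_le _ (mul_nonneg (sub_nonneg.2 hcd) (norm_nonneg _))).2
        fun s => ?_
      refine (intervalIntegral.norm_integral_le_of_norm_le_const
        fun σ _ => u.norm_coe_le_norm (projIcc c d hcd σ)).trans ?_
      rw [mul_comm]
      gcongr
      exact abs_sub_le_of_le_of_le s.2.1 s.2.2 t₀.2.1 t₀.2.2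

theorem integralOperator_apply {c d : ℝ} (hcd : c ≤ d) (t₀ : Icc c d) (u : C(Icc c d, E))
    (s : Icc c d) :
    integralOperator hcd t₀ u s = ∫ σ in (t₀ : ℝ)..s, IccExtend hcd u σ := rfl

theorem norm_integralOperator_le {c d : ℝ} (hcd : c ≤ d) (t₀ : Icc c d) :
    ‖integralOperator (E := E) hcd t₀‖ ≤ d - c :=
  LinearMap.mkContinuous_norm_le _ (sub_nonneg.2 hcd) _

end IntegralOperator

/-- If `Φ ∘ g = h` with `Φ` and `h` of class `Cᵏ`, `g` continuous and the derivative of `Φ`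
invertible, then `g` is of class `Cᵏ`. -/
theorem contDiffAt_of_comp_eq {E X Y : Type*} [NormedAddCommGroup E] [NormedSpace ℝ E]
    [NormedAddCommGroup X] [NormedSpace ℝ X] [CompleteSpace X]
    [NormedAddCommGroup Y] [NormedSpace ℝ Y] {k : WithTop ℕ∞} (hk : k ≠ 0)
    {Φ : X → Y} {g : E → X} {h : E → Y} {x : E} {Φ' : X ≃L[ℝ] Y}
    (hΦ : ContDiffAt ℝ k Φ (g x)) (hΦ' : HasFDerivAt Φ (Φ' : X →L[ℝ] Y) (g x))
    (hg : ContinuousAt g x) (hh : ContDiffAt ℝ k h x) (heq : ∀ y, Φ (g y) = h y) :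
    ContDiffAt ℝ k g x := by
  have hinv := hΦ.to_localInverse hΦ' hk
  rw [heq x] at hinv
  refine (hinv.comp x hh).congr_of_eventuallyEq ?_
  filter_upwards [hg.eventually (hΦ.hasStrictFDerivAt' hΦ' hk).eventually_left_inverse]
    with y hy
  rw [Function.comp_apply, ← heq y]
  exact hy.symm

/-- **Cᵏ regularity of the time-(τ₀,τ) solution maps.**
Let `V : ℝ × ℝⁿ → ℝⁿ` be continuous and bounded, uniformly Lipschitz in the second variable
with constant `C > 0`. Let `k ≥ 1` and assume for each `1 ≤ j ≤ k` and every `τ` the `j`-th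
Fréchet derivative of `y ↦ V (τ, y)` exists (i.e. `y ↦ V (τ, y)` is `Cᵏ`) and
`(τ, y) ↦ D_y^j V (τ, y)` is continuous on `ℝ × ℝⁿ`. Let `I₀ = Ioo a b` be an open interval
of length less than `1/C`. Then for any local flow map `θ` for `V` on `I₀` and any fixed
`τ, τ₀ ∈ I₀`, the map `x ↦ θ τ τ₀ x` is `Cᵏ`. -/
theorem stmt_4 {n : ℕ} (hn : 1 ≤ n)
    (V : ℝ × EuclideanSpace ℝ (Fin n) → EuclideanSpace ℝ (Fin n))
    (C : ℝ) (hC : 0 < C)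
    (hVcont : Continuous V)
    (hVbdd : ∃ M : ℝ, ∀ p, ‖V p‖ ≤ M)
    (hVlip : ∀ (τ : ℝ) (y₁ y₂ : EuclideanSpace ℝ (Fin n)),
      ‖V (τ, y₁) - V (τ, y₂)‖ ≤ C * ‖y₁ - y₂‖)
    (k : ℕ) (hk : 1 ≤ k)
    (hVk : ∀ τ : ℝ, ContDiff ℝ (k : ℕ∞) (fun y => V (τ, y)))
    (hDVcont : ∀ j : ℕ, 1 ≤ j → j ≤ k →
      Continuous (fun p : ℝ × EuclideanSpace ℝ (Fin n) =>
        iteratedFDeriv ℝ j (fun y => V (p.1, y)) p.2))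
    (a b : ℝ) (hab : a < b) (hlen : b - a < 1 / C)
    (θ : ℝ → ℝ → EuclideanSpace ℝ (Fin n) → EuclideanSpace ℝ (Fin n))
    (hθ : IsLocalFlowMap V (Set.Ioo a b) θ) :
    ∀ τ ∈ Set.Ioo a b, ∀ τ₀ ∈ Set.Ioo a b,
      ContDiff ℝ (k : ℕ∞) (fun x : EuclideanSpace ℝ (Fin n) => θ τ τ₀ x) := by
  intro τ hτ τ₀ hτ₀
  have hcd : min τ τ₀ ≤ max τ τ₀ := min_le_max
  set c := min τ τ₀
  set d := max τ τ₀
  have hsub : Set.Icc c d ⊆ Set.Ioo a b := fun s hs =>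
    ⟨(lt_min hτ.1 hτ₀.1).trans_le hs.1, hs.2.trans_lt (max_lt hτ.2 hτ₀.2)⟩
  have hlt : (d - c) * C < 1 := by
    have h₁ : d - c < b - a := by
      have := (hsub ⟨le_rfl, hcd⟩).1
      have := (hsub ⟨hcd, le_rfl⟩).2
      linarith
    rw [← lt_div_iff₀ hC]
    exact h₁.trans hlen
  have hdc : 0 ≤ d - c := sub_nonneg.2 hcd
  have hk' : ((k : ℕ∞) : WithTop ℕ∞) = (k : WithTop ℕ∞) := rfl
  rw [hk'] at hVk ⊢
  have hk0 : (k : WithTop ℕ∞) ≠ 0 := by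
    exact_mod_cast (by omega : k ≠ 0)
  let X := C(Set.Icc c d, EuclideanSpace ℝ (Fin n))
  let t₀ : Set.Icc c d := ⟨τ₀, min_le_right _ _, le_max_right _ _⟩
  let t₁ : Set.Icc c d := ⟨τ, min_le_left _ _, le_max_left _ _⟩
  let J : X →L[ℝ] X := integralOperator hcd t₀
  have hJ : ‖J‖ ≤ d - c := norm_integralOperator_le hcd t₀
  have hι : Continuous fun p : Set.Icc c d × EuclideanSpace ℝ (Fin n) => ((p.1 : ℝ), p.2) := by
    fun_prop
  let f : C(Set.Icc c d × EuclideanSpace ℝ (Fin n), EuclideanSpace ℝ (Fin n)) :=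
    ⟨fun p => V (p.1, p.2), hVcont.comp hι⟩
  let f' : C(Set.Icc c d × EuclideanSpace ℝ (Fin n),
      EuclideanSpace ℝ (Fin n) →L[ℝ] EuclideanSpace ℝ (Fin n)) :=
    ⟨fun p => fderiv ℝ (fun y => V (p.1, y)) p.2,
      (continuous_fderiv_snd (hDVcont 1 le_rfl hk)).comp hι⟩
  have hNf : ContDiff ℝ k (nemytskii f) :=
    contDiff_nemytskii k f (fun t => hVk t) fun j hj hjk => (hDVcont j hj hjk).comp hι
  have hNlip : ∀ γ₁ γ₂ : X, ‖nemytskii f γ₁ - nemytskii f γ₂‖ ≤ C * ‖γ₁ - γ₂‖ := fun γ₁ γ₂ =>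
    (ContinuousMap.norm_le _ (by positivity)).2 fun t => (hVlip t _ _).trans
      (by gcongr; exact (γ₁ - γ₂).norm_coe_le_norm t)
  let Φ : X → X := fun γ => γ - J (nemytskii f γ)
  have hΦ : ContDiff ℝ k Φ := contDiff_id.sub (J.contDiff.comp hNf)
  let A : X → X →L[ℝ] X := fun γ => J.comp (pointwiseApply _ _ _ (nemytskii f' γ))
  have hA : ∀ γ, ‖A γ‖ < 1 := fun γ => by
    refine lt_of_le_of_lt ?_ hlt
    refine (ContinuousLinearMap.opNorm_comp_le _ _).trans ?_
    gcongr
    refine norm_pointwiseApply_le _ hC.le fun t => ?_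
    exact norm_fderiv_le_of_lip' ℝ hC.le (Filter.Eventually.of_forall fun y => hVlip t y _)
  have hΦ' : ∀ γ, HasFDerivAt Φ
      ((ContinuousLinearEquiv.ofUnit (Units.oneSub (A γ) (hA γ)) : X ≃L[ℝ] X) : X →L[ℝ] X) γ :=
    fun γ => (hasFDerivAt_id γ).sub (J.hasFDerivAt.comp γ
      (hasFDerivAt_nemytskii f f'
        (fun t y => ((hVk t).differentiable hk0 y).hasFDerivAt) γ))
  let g : EuclideanSpace ℝ (Fin n) → X := fun x =>
    ⟨fun s => θ s τ₀ x, continuous_iff_continuousAt.2 fun s =>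
      ((hθ τ₀ hτ₀ x).2 s (hsub s.2)).continuousAt.comp continuous_subtype_val.continuousAt⟩
  have hΦg : ∀ x, Φ (g x) = ContinuousMap.const _ x := by
    intro x
    ext1 s
    have hu : Set.uIcc τ₀ (s : ℝ) ⊆ Set.Icc c d := Set.uIcc_subset_Icc t₀.2 s.2
    have hderiv : ∀ σ ∈ Set.uIcc τ₀ (s : ℝ), HasDerivAt (fun r => θ r τ₀ x)
        (Set.IccExtend hcd (nemytskii f (g x)) σ) σ := by
      intro σ hσ
      rw [Set.IccExtend_of_mem hcd _ (hu hσ)]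
      exact (hθ τ₀ hτ₀ x).2 σ (hsub (hu hσ))
    have hint := intervalIntegral.integral_eq_sub_of_hasDerivAt hderiv
      ((nemytskii f (g x)).continuous.Icc_extend'.intervalIntegrable _ _)
    rw [(hθ τ₀ hτ₀ x).1] at hint
    change θ s τ₀ x - J (nemytskii f (g x)) s = x
    rw [integralOperator_apply, hint, sub_sub_cancel]
  have hgcont : Continuous g := by
    have hpos : 0 < 1 - (d - c) * C := sub_pos.2 hlt
    refine (LipschitzWith.of_dist_le_mul (K := ⟨(1 - (d - c) * C)⁻¹, by positivity⟩)
      fun x y => ?_).continuous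
    rw [dist_eq_norm, dist_eq_norm]
    change _ ≤ (1 - (d - c) * C)⁻¹ * _
    rw [inv_mul_eq_div, le_div_iff₀ hpos]
    have hsplit : g x - g y =
        ContinuousMap.const _ (x - y) + J (nemytskii f (g x) - nemytskii f (g y)) := by
      have hx : g x - J (nemytskii f (g x)) = ContinuousMap.const _ x := hΦg x
      have hy : g y - J (nemytskii f (g y)) = ContinuousMap.const _ y := hΦg y
      have hxy : (ContinuousMap.const _ (x - y) : X) =
        ContinuousMap.const _ x - ContinuousMap.const _ y := rfl
      rw [map_sub, hxy, ← hx, ← hy]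
      abel
    have hconst : ‖(ContinuousMap.const _ (x - y) : X)‖ ≤ ‖x - y‖ :=
      (ContinuousMap.norm_le _ (norm_nonneg _)).2 fun _ => le_rfl
    have hJN : ‖J (nemytskii f (g x) - nemytskii f (g y))‖ ≤ (d - c) * (C * ‖g x - g y‖) :=
      J.le_of_opNorm_le_of_le hJ (hNlip _ _)
    have := (congrArg norm hsplit).le.trans (norm_add_le _ _)
    linarith
  have hconst : ContDiff ℝ k
      (fun x : EuclideanSpace ℝ (Fin n) => (ContinuousMap.const _ x : X)) :=
    (ContinuousLinearMap.const (R := ℝ) (M := EuclideanSpace ℝ (Fin n)) (Set.Icc c d)).contDiff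
  have hg : ContDiff ℝ k g := contDiff_iff_contDiffAt.2 fun x =>
    contDiffAt_of_comp_eq hk0 hΦ.contDiffAt (hΦ' _) hgcont.continuousAt hconst.contDiffAt hΦg
  exact (ContinuousMap.evalCLM ℝ t₁).contDiff.comp hg
end

section
/- Let k ≥ 1 and assume in addition that for each 1 ≤ j ≤ k and every τ ∈ ℝ the j-th Fréchet derivative of y ↦ V(τ, y) exists and the map (τ, y) ↦ D_y^j V(τ, y) is continuous on ℝ × ℝⁿ. Then for any local flow map θ for V on I₀ and each 1 ≤ j ≤ k, the j-th iterated Fréchet derivative of θ with respect to the third variable exists everywhere and the map (τ, τ₀, x) ↦ D_x^j θ(τ, τ₀, x) is continuous on I₀ × I₀ × ℝⁿ. -/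
open Set Filter Topology Function Interval

universe u

section Gronwall

variable {E : Type*} [NormedAddCommGroup E] [NormedSpace ℝ E]

/-- Forward Grönwall estimate in which the differential inequality is only required while `f`
stays in a ball that the resulting bound never leaves. -/
theorem norm_le_mul_exp_of_norm_deriv_le_right {f f' : ℝ → E} {s u D K η r : ℝ}
    (hD : 0 < D) (hη : η < D) (hK : 0 ≤ K)
    (hf : ∀ t ∈ Icc s u, HasDerivAt f (f' t) t) (h0 : ‖f s‖ ≤ D)
    (hr : D * Real.exp ((K + 1) * (u - s)) ≤ r)
    (hb : ∀ t ∈ Icc s u, ‖f t‖ ≤ r → ‖f' t‖ ≤ K * ‖f t‖ + η) :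
    ∀ t ∈ Icc s u, ‖f t‖ ≤ D * Real.exp ((K + 1) * (t - s)) := by
  have hB : ∀ t, HasDerivAt (fun t => D * Real.exp ((K + 1) * (t - s)))
      ((K + 1) * (D * Real.exp ((K + 1) * (t - s)))) t := by
    intro t
    have h1 : HasDerivAt (fun t => (K + 1) * (t - s)) ((K + 1) * 1) t :=
      ((hasDerivAt_id t).sub_const s).const_mul (K + 1)
    exact (h1.exp.const_mul D).congr_deriv (by ring)
  intro t ht
  refine image_norm_le_of_norm_deriv_right_lt_deriv_boundary
    (fun t ht => (hf t ht).continuousAt.continuousWithinAt)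
    (fun t ht => (hf t (Ico_subset_Icc_self ht)).hasDerivWithinAt) (by simpa using h0) hB ?_ ht
  intro x hx hfx
  have hxI := Ico_subset_Icc_self hx
  have hle : D * Real.exp ((K + 1) * (x - s)) ≤ r := by
    refine le_trans ?_ hr
    have := hx.2.le
    gcongr
  have h1 := hb x hxI (hfx ▸ hle)
  have h2 : D * 1 ≤ D * Real.exp ((K + 1) * (x - s)) := by
    have : 0 ≤ (K + 1) * (x - s) := mul_nonneg (by linarith) (by linarith [hx.1])
    gcongr
    exact Real.one_le_exp this
  rw [hfx] at h1
  linarith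

/-- Two-sided version of `norm_le_mul_exp_of_norm_deriv_le_right`. -/
theorem norm_le_mul_exp_of_norm_deriv_le {f f' : ℝ → E} {α β t₀ D K η r : ℝ}
    (hD : 0 < D) (hη : η < D) (hK : 0 ≤ K) (ht₀ : t₀ ∈ Icc α β)
    (hf : ∀ t ∈ Icc α β, HasDerivAt f (f' t) t) (h0 : ‖f t₀‖ ≤ D)
    (hr : D * Real.exp ((K + 1) * (β - α)) ≤ r)
    (hb : ∀ t ∈ Icc α β, ‖f t‖ ≤ r → ‖f' t‖ ≤ K * ‖f t‖ + η) :
    ∀ t ∈ Icc α β, ‖f t‖ ≤ D * Real.exp ((K + 1) * (β - α)) := by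
  have hmono : ∀ d, d ≤ β - α →
      D * Real.exp ((K + 1) * d) ≤ D * Real.exp ((K + 1) * (β - α)) := by
    intro d hd
    gcongr
  intro t ht
  rcases le_total t₀ t with h | h
  · refine (norm_le_mul_exp_of_norm_deriv_le_right (u := β) (r := r) hD hη hK
      (fun t ht => hf t ⟨ht₀.1.trans ht.1, ht.2⟩) h0
      ((hmono _ (by linarith [ht₀.1])).trans hr)
      (fun t ht => hb t ⟨ht₀.1.trans ht.1, ht.2⟩) t ⟨h, ht.2⟩).trans (hmono _ ?_)
    linarith [ht.2, ht₀.1]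
  · have hmem : ∀ s ∈ Icc (-t₀) (-α), -s ∈ Icc α β := fun s hs =>
      ⟨by linarith [hs.2], by linarith [hs.1, ht₀.2]⟩
    have := norm_le_mul_exp_of_norm_deriv_le_right (f := fun s => f (-s))
      (f' := fun s => -f' (-s)) (s := -t₀) (u := -α) (r := r) hD hη hK
      (fun s hs => by
        simpa [comp_def] using (hf (-s) (hmem s hs)).scomp s (hasDerivAt_neg s))
      (by simpa using h0) ((hmono _ (by linarith [ht₀.2])).trans hr)
      (fun s hs hs' => by simpa using hb (-s) (hmem s hs) hs') (-t)
      ⟨by linarith, by linarith [ht.1]⟩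
    simp only [neg_neg] at this
    refine this.trans (hmono _ ?_)
    linarith [ht.1, ht₀.2]

end Gronwall

section LinearODE

variable {F : Type*} [NormedAddCommGroup F] [NormedSpace ℝ F]

/-- The Picard series of the linear equation `y' = A y`. -/
noncomputable def linearPicardTerm (A : ℝ → F →L[ℝ] F) (t₀ : ℝ) (y₀ : F) : ℕ → ℝ → F
  | 0 => fun _ => y₀
  | n + 1 => fun t => ∫ s in t₀..t, A s (linearPicardTerm A t₀ y₀ n s)

theorem continuous_linearPicardTerm {A : ℝ → F →L[ℝ] F} (hA : Continuous A) (t₀ : ℝ) (y₀ : F)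
    (n : ℕ) : Continuous (linearPicardTerm A t₀ y₀ n) := by
  induction n with
  | zero => exact continuous_const
  | succ n ih =>
    exact intervalIntegral.continuous_primitive
      (fun a b => (hA.clm_apply ih).intervalIntegrable a b) t₀

theorem hasDerivAt_linearPicardTerm [CompleteSpace F] {A : ℝ → F →L[ℝ] F} (hA : Continuous A) (t₀ : ℝ) (y₀ : F)
    (n : ℕ) (t : ℝ) :
    HasDerivAt (linearPicardTerm A t₀ y₀ (n + 1)) (A t (linearPicardTerm A t₀ y₀ n t)) t :=
  have hc := hA.clm_apply (continuous_linearPicardTerm hA t₀ y₀ n)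
  intervalIntegral.integral_hasDerivAt_right (hc.intervalIntegrable _ _)
    (hc.stronglyMeasurableAtFilter _ _) hc.continuousAt

theorem norm_linearPicardTerm_le {A : ℝ → F →L[ℝ] F} (hA : Continuous A) {M : ℝ}
    (hM : ∀ t, ‖A t‖ ≤ M) (t₀ : ℝ) (y₀ : F) (n : ℕ) (t : ℝ) :
    ‖linearPicardTerm A t₀ y₀ n t‖ ≤ (M * |t - t₀|) ^ n / n.factorial * ‖y₀‖ := by
  have hM0 : 0 ≤ M := (norm_nonneg _).trans (hM 0)
  induction n generalizing t with
  | zero => simp [linearPicardTerm]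
  | succ n ih =>
    have hc := hA.clm_apply (continuous_linearPicardTerm hA t₀ y₀ n)
    have hb : Continuous fun s => M ^ (n + 1) / n.factorial * ‖y₀‖ * |s - t₀| ^ n := by fun_prop
    calc ‖linearPicardTerm A t₀ y₀ (n + 1) t‖
        ≤ ∫ s in Ι t₀ t, ‖A s (linearPicardTerm A t₀ y₀ n s)‖ :=
          intervalIntegral.norm_integral_le_integral_norm_uIoc
      _ ≤ ∫ s in Ι t₀ t, M ^ (n + 1) / n.factorial * ‖y₀‖ * |s - t₀| ^ n := by
          refine MeasureTheory.setIntegral_mono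
            (intervalIntegrable_iff.1 (hc.norm.intervalIntegrable _ _))
            (intervalIntegrable_iff.1 (hb.intervalIntegrable _ _)) fun s => ?_
          calc ‖A s (linearPicardTerm A t₀ y₀ n s)‖
              ≤ M * ((M * |s - t₀|) ^ n / n.factorial * ‖y₀‖) :=
                (A s).le_of_opNorm_le_of_le (hM s) (ih s)
            _ = M ^ (n + 1) / n.factorial * ‖y₀‖ * |s - t₀| ^ n := by ring
      _ = (M * |t - t₀|) ^ (n + 1) / (n + 1).factorial * ‖y₀‖ := by
          rw [MeasureTheory.integral_const_mul, integral_pow_abs_sub_uIoc, Nat.factorial_succ]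
          push_cast
          rw [mul_pow]
          field_simp

/-- A linear differential equation with bounded continuous coefficient has global solutions. -/
theorem exists_linearODE_solution [CompleteSpace F] {A : ℝ → F →L[ℝ] F} (hA : Continuous A) {M : ℝ}
    (hM : ∀ t, ‖A t‖ ≤ M) (t₀ : ℝ) (y₀ : F) :
    ∃ y : ℝ → F, y t₀ = y₀ ∧ ∀ t, HasDerivAt y (A t (y t)) t := by
  have hM0 : 0 ≤ M := (norm_nonneg _).trans (hM 0)
  set p := linearPicardTerm A t₀ y₀ with hp
  have hsum : ∀ R, Summable fun n : ℕ => (M * R) ^ n / n.factorial * ‖y₀‖ := fun R =>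
    (Real.summable_pow_div_factorial (M * R)).mul_right _
  have hps : ∀ t, Summable fun n => p n t := fun t =>
    .of_norm_bounded (hsum |t - t₀|) fun n => norm_linearPicardTerm_le hA hM t₀ y₀ n t
  have hpt₀ : ∀ n, p (n + 1) t₀ = 0 := fun n => intervalIntegral.integral_same
  refine ⟨fun t => y₀ + ∑' n, p (n + 1) t, by simp [hpt₀], fun t => ?_⟩
  have hd : HasDerivAt (fun t => ∑' n, p (n + 1) t) (∑' n, A t (p n t)) t := by
    refine hasDerivAt_tsum_of_isPreconnected (t := Metric.ball t₀ (|t - t₀| + 1)) (y₀ := t₀)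
      ((hsum (|t - t₀| + 1)).mul_left M) Metric.isOpen_ball
      (convex_ball _ _).isPreconnected
      (fun n s _ => hasDerivAt_linearPicardTerm hA t₀ y₀ n s) (fun n s hs => ?_)
      (Metric.mem_ball_self (by positivity)) (summable_zero.congr fun n => (hpt₀ n).symm)
      (by simp [Real.dist_eq])
    refine (A s).le_of_opNorm_le_of_le (hM s)
      ((norm_linearPicardTerm_le hA hM t₀ y₀ n s).trans ?_)
    have : |s - t₀| ≤ |t - t₀| + 1 := (Metric.mem_ball.1 hs).le
    gcongr
  convert hd.const_add y₀ using 1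
  rw [← (A t).map_tsum (hps t), (hps t).tsum_eq_zero_add]
  rfl

end LinearODE

section ParamContDiff

variable {P : Type*} [TopologicalSpace P]
  {E E' F F' G : Type u} [NormedAddCommGroup E] [NormedSpace ℝ E]
  [NormedAddCommGroup E'] [NormedSpace ℝ E'] [NormedAddCommGroup F] [NormedSpace ℝ F]
  [NormedAddCommGroup F'] [NormedSpace ℝ F'] [NormedAddCommGroup G] [NormedSpace ℝ G]

/-- `ParamContDiff S k f` says that, for `p ∈ S`, the map `f p` is `k` times differentiable and
its derivatives up to order `k` are jointly continuous in the parameter and the point. -/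
def ParamContDiff (S : Set P) : ℕ → ∀ {F : Type u} [NormedAddCommGroup F] [NormedSpace ℝ F],
    (P → E → F) → Prop
  | 0, _, _, _, f => ContinuousOn (uncurry f) (S ×ˢ univ)
  | k + 1, _, _, _, f => ContinuousOn (uncurry f) (S ×ˢ univ) ∧
      (∀ p ∈ S, Differentiable ℝ (f p)) ∧ ParamContDiff S k fun p => fderiv ℝ (f p)

namespace ParamContDiff

variable {S : Set P} {k : ℕ} {f : P → E → F} {g : P → E → F'}

theorem continuousOn (h : ParamContDiff S k f) : ContinuousOn (uncurry f) (S ×ˢ univ) := by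
  cases k with
  | zero => exact h
  | succ k => exact h.1

theorem hasFDerivAt (h : ParamContDiff S (k + 1) f) {p : P} (hp : p ∈ S) (x : E) :
    HasFDerivAt (f p) (fderiv ℝ (f p) x) x :=
  (h.2.1 p hp x).hasFDerivAt

theorem of_succ (h : ParamContDiff S (k + 1) f) : ParamContDiff S k f := by
  induction k generalizing F with
  | zero => exact h.1
  | succ k ih => exact ⟨h.1, h.2.1, ih h.2.2⟩

theorem congr {f₁ : P → E → F} (h : ParamContDiff S k f) (hf : ∀ p ∈ S, f p = f₁ p) :
    ParamContDiff S k f₁ := by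
  have hc : ∀ {j : ℕ}, ParamContDiff S j f → ContinuousOn (uncurry f₁) (S ×ˢ univ) := fun h =>
    h.continuousOn.congr fun q hq => (congrFun (hf q.1 hq.1) q.2).symm
  induction k generalizing F with
  | zero => exact hc h
  | succ k ih =>
    exact ⟨hc h, fun p hp => hf p hp ▸ h.2.1 p hp,
      ih h.2.2 (fun p hp => by rw [hf p hp]) fun h =>
        h.continuousOn.congr fun q hq => by simp only [uncurry, hf q.1 hq.1]⟩

theorem succ_of_hasFDerivAt {f' : P → E → E →L[ℝ] F}
    (hf : ContinuousOn (uncurry f) (S ×ˢ univ))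
    (hd : ∀ p ∈ S, ∀ x, HasFDerivAt (f p) (f' p x) x) (h : ParamContDiff S k f') :
    ParamContDiff S (k + 1) f :=
  ⟨hf, fun p hp x => (hd p hp x).differentiableAt,
    h.congr fun p hp => funext fun x => (hd p hp x).fderiv.symm⟩

theorem const (c : F) : ParamContDiff S k fun (_ : P) (_ : E) => c := by
  induction k generalizing F with
  | zero => exact continuousOn_const
  | succ k ih =>
    exact succ_of_hasFDerivAt continuousOn_const (fun p _ x => hasFDerivAt_const c x) (ih 0)

theorem clm (L : E →L[ℝ] F) : ParamContDiff S k fun (_ : P) x => L x := by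
  have hc : ContinuousOn (uncurry fun (_ : P) x => L x) (S ×ˢ univ) :=
    (L.continuous.comp continuous_snd).continuousOn
  cases k with
  | zero => exact hc
  | succ k => exact succ_of_hasFDerivAt hc (fun p _ x => L.hasFDerivAt) (const L)

theorem clm_comp (L : F →L[ℝ] F') (h : ParamContDiff S k f) :
    ParamContDiff S k fun p x => L (f p x) := by
  induction k generalizing F F' with
  | zero => exact L.continuous.comp_continuousOn h.continuousOn
  | succ k ih =>
    exact succ_of_hasFDerivAt (L.continuous.comp_continuousOn h.continuousOn)
      (fun p hp x => L.hasFDerivAt.comp x (h.hasFDerivAt hp x))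
      (ih (ContinuousLinearMap.compL ℝ E F F' L) h.2.2)

theorem add {f₁ : P → E → F} (h : ParamContDiff S k f) (h₁ : ParamContDiff S k f₁) :
    ParamContDiff S k fun p x => f p x + f₁ p x := by
  induction k generalizing F with
  | zero => exact h.continuousOn.add h₁.continuousOn
  | succ k ih =>
    exact succ_of_hasFDerivAt (h.continuousOn.add h₁.continuousOn)
      (fun p hp x => (h.hasFDerivAt hp x).add (h₁.hasFDerivAt hp x)) (ih h.2.2 h₁.2.2)

theorem prodMk (h : ParamContDiff S k f) (hg : ParamContDiff S k g) :
    ParamContDiff S k fun p x => (f p x, g p x) := by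
  simpa using (h.clm_comp (.inl ℝ F F')).add (hg.clm_comp (.inr ℝ F F'))

theorem bilinear (B : F →L[ℝ] F' →L[ℝ] G) (h : ParamContDiff S k f)
    (hg : ParamContDiff S k g) : ParamContDiff S k fun p x => B (f p x) (g p x) := by
  induction k generalizing F F' G with
  | zero => exact (B.continuous.comp_continuousOn h.continuousOn).clm_apply hg.continuousOn
  | succ k ih =>
    exact succ_of_hasFDerivAt ((B.continuous.comp_continuousOn h.continuousOn).clm_apply hg.continuousOn)
      (fun p hp x => B.hasFDerivAt_of_bilinear (h.hasFDerivAt hp x) (hg.hasFDerivAt hp x))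
      ((ih (B.precompR E) h.of_succ hg.2.2).add (ih (B.precompL E) h.2.2 hg.of_succ))

theorem comp_affine (h : ParamContDiff S k f) {a : E' → E} {L : E' →L[ℝ] E}
    (ha : ∀ x, HasFDerivAt a L x) : ParamContDiff S k fun p x => f p (a x) := by
  have hac : Continuous a := continuous_iff_continuousAt.2 fun x => (ha x).continuousAt
  have hc : ∀ {H : Type u} [NormedAddCommGroup H] [NormedSpace ℝ H] {f : P → E → H},
      ContinuousOn (uncurry f) (S ×ˢ univ) →
      ContinuousOn (uncurry fun p x => f p (a x)) (S ×ˢ univ) := fun hf =>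
    hf.comp (f := fun q : P × E' => (q.1, a q.2)) (by fun_prop) fun q hq => ⟨hq.1, trivial⟩
  induction k generalizing F with
  | zero => exact hc h
  | succ k ih =>
    exact succ_of_hasFDerivAt (hc h.continuousOn)
      (fun p hp x => (h.hasFDerivAt hp (a x)).comp x (ha x))
      ((ih h.2.2).clm_comp ((ContinuousLinearMap.compL ℝ E' E F).flip L))

theorem contDiff (h : ParamContDiff S k f) {p : P} (hp : p ∈ S) : ContDiff ℝ k (f p) := by
  induction k generalizing F with
  | zero =>
    refine contDiff_zero.2 (continuousOn_univ.1 ?_)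
    exact h.continuousOn.comp (f := fun x : E => (p, x)) (by fun_prop) fun x _ => ⟨hp, trivial⟩
  | succ k ih =>
    push_cast
    exact contDiff_succ_iff_fderiv.2 ⟨h.2.1 p hp, by simp, ih h.2.2⟩

theorem continuousOn_iteratedFDeriv (h : ParamContDiff S k f) {j : ℕ} (hj : j ≤ k) :
    ContinuousOn (fun q : P × E => iteratedFDeriv ℝ j (f q.1) q.2) (S ×ˢ univ) := by
  induction k generalizing F j with
  | zero =>
    obtain rfl : j = 0 := by omega
    simp only [iteratedFDeriv_zero_eq_comp]
    exact (continuousMultilinearCurryFin0 ℝ E F).symm.continuous.comp_continuousOn h.continuousOn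
  | succ k ih =>
    cases j with
    | zero =>
      simp only [iteratedFDeriv_zero_eq_comp]
      exact (continuousMultilinearCurryFin0 ℝ E F).symm.continuous.comp_continuousOn
        h.continuousOn
    | succ j =>
      simp only [iteratedFDeriv_succ_eq_comp_right]
      exact (continuousMultilinearCurryRightEquiv' ℝ j E F).symm.continuous.comp_continuousOn
        (ih h.2.2 (Nat.le_of_succ_le_succ hj))

theorem of_continuousOn_iteratedFDeriv (hf : ∀ p ∈ S, ContDiff ℝ k (f p))
    (hc : ∀ j ≤ k,
      ContinuousOn (fun q : P × E => iteratedFDeriv ℝ j (f q.1) q.2) (S ×ˢ univ)) :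
    ParamContDiff S k f := by
  have h0 : ContinuousOn (uncurry f) (S ×ˢ univ) := by
    have := (continuousMultilinearCurryFin0 ℝ E F).continuous.comp_continuousOn (hc 0 k.zero_le)
    simpa [comp_def, uncurry_def, iteratedFDeriv_zero_eq_comp] using this
  induction k generalizing F with
  | zero => exact h0
  | succ k ih =>
    push_cast at hf
    have hc' : ∀ j ≤ k, ContinuousOn
        (fun q : P × E => iteratedFDeriv ℝ j (fderiv ℝ (f q.1)) q.2) (S ×ˢ univ) := by
      intro j hj
      have := (continuousMultilinearCurryRightEquiv' ℝ j E F).continuous.comp_continuousOn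
        (hc (j + 1) (Nat.succ_le_succ hj))
      simpa [comp_def, iteratedFDeriv_succ_eq_comp_right] using this
    refine ⟨h0, fun p hp => (contDiff_succ_iff_fderiv.1 (hf p hp)).1,
      ih (fun p hp => (contDiff_succ_iff_fderiv.1 (hf p hp)).2.2) hc' ?_⟩
    have := (continuousMultilinearCurryFin0 ℝ E (E →L[ℝ] F)).continuous.comp_continuousOn
      (hc' 0 k.zero_le)
    simpa [comp_def, uncurry_def, iteratedFDeriv_zero_eq_comp] using this

end ParamContDiff

end ParamContDiff
section Flow

variable {E : Type u} [NormedAddCommGroup E]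

/-- A jointly continuous map varies uniformly little near a compact curve. -/
theorem exists_tube {F : Type*} [NormedAddCommGroup F] {W : ℝ → E → F}
    (hW : Continuous (uncurry W)) {γ : ℝ → E} {α β : ℝ} (hγ : ContinuousOn γ (Icc α β))
    {η : ℝ} (hη : 0 < η) :
    ∃ ε > 0, ∀ t ∈ Icc α β, ∀ y, ‖y - γ t‖ ≤ ε → ‖W t y - W t (γ t)‖ ≤ η := by
  have hK : IsCompact ((fun t => (t, γ t)) '' Icc α β) :=
    isCompact_Icc.image_of_continuousOn (continuousOn_id.prodMk hγ)
  obtain ⟨ε, hε, h⟩ := Metric.mem_uniformity_dist.1 (hK.uniformContinuousAt_of_continuousAt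
    (uncurry W) (fun p _ => hW.continuousAt) (Metric.dist_mem_uniformity hη))
  refine ⟨ε / 2, half_pos hε, fun t ht y hy => ?_⟩
  have hd : dist (t, γ t) (t, y) < ε := by
    rw [Prod.dist_eq, dist_self, max_eq_right dist_nonneg, dist_comm, dist_eq_norm]
    linarith
  have := h hd ⟨t, ht, rfl⟩
  simp only [mem_ofPred_eq, uncurry_apply_pair] at this
  rw [← dist_eq_norm, dist_comm]
  exact this.le

theorem exists_norm_le_along {F : Type*} [NormedAddCommGroup F] {W : ℝ → E → F}
    (hW : Continuous (uncurry W)) {γ : ℝ → E} {α β : ℝ} (hγ : ContinuousOn γ (Icc α β)) :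
    ∃ K, 0 ≤ K ∧ ∀ t ∈ Icc α β, ‖W t (γ t)‖ ≤ K := by
  obtain ⟨K, hK⟩ := isCompact_Icc.exists_bound_of_continuousOn
    (hW.comp_continuousOn (continuousOn_id.prodMk hγ))
  exact ⟨max K 0, le_max_right _ _, fun t ht => (hK t ht).trans (le_max_left _ _)⟩

variable [NormedSpace ℝ E]

/-- First-order expansion of a vector field, uniform along a compact curve. -/
theorem exists_tube_norm_sub_sub_le {V : ℝ → E → E} {V' : ℝ → E → E →L[ℝ] E}
    (hV : ∀ t y, HasFDerivAt (V t) (V' t y) y) (hV' : Continuous (uncurry V'))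
    {γ : ℝ → E} {α β : ℝ} (hγ : ContinuousOn γ (Icc α β)) {η : ℝ} (hη : 0 < η) :
    ∃ ε > 0, ∀ t ∈ Icc α β, ∀ y, ‖y - γ t‖ ≤ ε →
      ‖V t y - V t (γ t) - V' t (γ t) (y - γ t)‖ ≤ η * ‖y - γ t‖ := by
  obtain ⟨ε, hε, h⟩ := exists_tube hV' hγ hη
  refine ⟨ε, hε, fun t ht y hy => ?_⟩
  exact Convex.norm_image_sub_le_of_norm_hasFDerivWithin_le'
    (s := Metric.closedBall (γ t) ε) (f' := V' t)
    (fun z _ => (hV t z).hasFDerivWithinAt)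
    (fun z hz => h t ht z (by simpa [dist_eq_norm] using hz)) (convex_closedBall _ _)
    (Metric.mem_closedBall_self hε.le) (by simpa [dist_eq_norm] using hy)

/-- Continuity of a family of curves from uniform convergence. -/
theorem continuousAt_uncurry_of_forall_Icc {Q F : Type*} [TopologicalSpace Q]
    [NormedAddCommGroup F] {g : ℝ → Q → F} {α β t : ℝ} {q : Q} (ht : t ∈ Ioo α β)
    (hc : ContinuousAt (fun s => g s q) t)
    (h : ∀ D > 0, ∀ᶠ r in 𝓝 q, ∀ s ∈ Icc α β, ‖g s r - g s q‖ ≤ D) :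
    ContinuousAt (uncurry g) (t, q) := by
  refine Metric.continuousAt_iff'.2 fun ε hε => ?_
  have h1 := (Metric.continuousAt_iff'.1 hc (ε / 2) (half_pos hε)).and (Ioo_mem_nhds ht.1 ht.2)
  rw [nhds_prod_eq]
  filter_upwards [h1.prod_mk (h (ε / 3) (by positivity))] with p hp
  have h2 := hp.2 p.1 (Ioo_subset_Icc_self hp.1.2)
  rw [← dist_eq_norm] at h2
  calc dist (uncurry g p) (uncurry g (t, q))
      ≤ dist (g p.1 p.2) (g p.1 q) + dist (g p.1 q) (g t q) := dist_triangle _ _ _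
    _ < ε := by linarith [hp.1.1]

theorem exists_Icc_subset_Ioo {a b s t : ℝ} (hs : s ∈ Ioo a b) (ht : t ∈ Ioo a b) :
    ∃ α β, Icc α β ⊆ Ioo a b ∧ s ∈ Ioo α β ∧ t ∈ Ioo α β := by
  obtain ⟨α, hα, hα'⟩ := exists_between (lt_min hs.1 ht.1)
  obtain ⟨β, hβ', hβ⟩ := exists_between (max_lt hs.2 ht.2)
  exact ⟨α, β, Icc_subset_Ioo hα hβ, ⟨hα'.trans_le (min_le_left _ _),
    (le_max_left _ _).trans_lt hβ'⟩, ⟨hα'.trans_le (min_le_right _ _),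
    (le_max_right _ _).trans_lt hβ'⟩⟩

/-- `θ` is a flow map on `I` of the time-dependent vector field `V`. -/
def IsFlowMapOn (V : ℝ → E → E) (I : Set ℝ) (θ : ℝ → ℝ → E → E) : Prop :=
  ∀ τ₀ ∈ I, ∀ x, θ τ₀ τ₀ x = x ∧ ∀ τ ∈ I, HasDerivAt (fun s => θ s τ₀ x) (V τ (θ τ τ₀ x)) τ

namespace IsFlowMapOn

variable {V : ℝ → E → E} {V' : ℝ → E → E →L[ℝ] E} {a b : ℝ} {θ : ℝ → ℝ → E → E}

theorem continuousOn_Icc {I : Set ℝ} (hθ : IsFlowMapOn V I θ) {τ₀ : ℝ} (hτ₀ : τ₀ ∈ I) (x : E)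
    {α β : ℝ} (hI : Icc α β ⊆ I) : ContinuousOn (fun t => θ t τ₀ x) (Icc α β) :=
  fun t ht => ((hθ τ₀ hτ₀ x).2 t (hI ht)).continuousAt.continuousWithinAt

/-- Nearby solutions depend on their data in a Lipschitz way, uniformly on compact intervals. -/
theorem exists_norm_sub_le {I : Set ℝ} (hθ : IsFlowMapOn V I θ)
    (hV : ∀ t y, HasFDerivAt (V t) (V' t y) y) (hV' : Continuous (uncurry V'))
    {α β : ℝ} (hI : Icc α β ⊆ I) {σ : ℝ} (hσ : σ ∈ I) (z : E) :
    ∃ M > 0, ∃ ε > 0, ∀ τ₀ ∈ Icc α β, ∀ x D, 0 < D → D ≤ ε → ‖x - θ τ₀ σ z‖ ≤ D →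
      ∀ t ∈ Icc α β, ‖θ t τ₀ x - θ t σ z‖ ≤ M * D := by
  have hγ := hθ.continuousOn_Icc hσ z hI
  obtain ⟨ε, hε, hT⟩ := exists_tube_norm_sub_sub_le hV hV' hγ one_pos
  obtain ⟨K, hK, hKb⟩ := exists_norm_le_along hV' hγ
  set M := Real.exp ((K + 1 + 1) * (β - α)) with hM
  have hM0 : 0 < M := Real.exp_pos _
  refine ⟨M, hM0, ε / M, by positivity, fun τ₀ hτ₀ x D hD hDε hx t ht => ?_⟩
  rw [mul_comm M]
  refine norm_le_mul_exp_of_norm_deriv_le (f := fun t => θ t τ₀ x - θ t σ z) (K := K + 1)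
    (η := 0) (r := ε) hD hD (by positivity) hτ₀
    (fun t ht => ((hθ τ₀ (hI hτ₀) x).2 t (hI ht)).sub ((hθ σ hσ z).2 t (hI ht)))
    (by rwa [(hθ τ₀ (hI hτ₀) x).1]) ((le_div_iff₀ hM0).1 hDε) (fun t ht hr => ?_) t ht
  have h1 := hT t ht _ hr
  have h2 := (V' t (θ t σ z)).le_of_opNorm_le (hKb t ht) (θ t τ₀ x - θ t σ z)
  have h3 := norm_le_norm_sub_add (V t (θ t τ₀ x) - V t (θ t σ z))
    (V' t (θ t σ z) (θ t τ₀ x - θ t σ z))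
  linarith

theorem eventually_norm_sub_le {I : Set ℝ} (hθ : IsFlowMapOn V I θ)
    (hV : ∀ t y, HasFDerivAt (V t) (V' t y) y) (hV' : Continuous (uncurry V'))
    {α β : ℝ} (hI : Icc α β ⊆ I) {σ : ℝ} (hσ : σ ∈ Ioo α β) (z : E) {D : ℝ} (hD : 0 < D) :
    ∀ᶠ q : ℝ × E in 𝓝 (σ, z), ∀ t ∈ Icc α β, ‖θ t q.1 q.2 - θ t σ z‖ ≤ D := by
  have hσI := hI (Ioo_subset_Icc_self hσ)
  obtain ⟨M, hM, ε, hε, h⟩ := hθ.exists_norm_sub_le hV hV' hI hσI z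
  have hδ : 0 < min ε (D / M) := by positivity
  have hc : ContinuousAt (fun q : ℝ × E => ‖q.2 - θ q.1 σ z‖) (σ, z) :=
    (continuousAt_snd.sub (ContinuousAt.comp (f := Prod.fst) (g := fun s => θ s σ z)
      ((hθ σ hσI z).2 σ hσI).continuousAt continuousAt_fst)).norm
  have h0 : ‖z - θ σ σ z‖ < min ε (D / M) := by simpa [(hθ σ hσI z).1] using hδ
  filter_upwards [hc.eventually_lt_const h0,
    continuousAt_fst.preimage_mem_nhds (Icc_mem_nhds hσ.1 hσ.2)] with q hq hq1 t ht
  refine (h q.1 hq1 q.2 _ hδ (min_le_left _ _) hq.le t ht).trans ?_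
  calc M * min ε (D / M) ≤ M * (D / M) := by gcongr; exact min_le_right _ _
    _ = D := by field_simp

theorem continuousOn_uncurry (hθ : IsFlowMapOn V (Ioo a b) θ)
    (hV : ∀ t y, HasFDerivAt (V t) (V' t y) y) (hV' : Continuous (uncurry V')) :
    ContinuousOn (uncurry fun t (q : ℝ × E) => θ t q.1 q.2) (Ioo a b ×ˢ Ioo a b ×ˢ univ) := by
  rintro ⟨t, σ, z⟩ ⟨ht, hσ, -⟩
  obtain ⟨α, β, hI, hσ', ht'⟩ := exists_Icc_subset_Ioo hσ ht
  exact (continuousAt_uncurry_of_forall_Icc (g := fun t (q : ℝ × E) => θ t q.1 q.2) (q := (σ, z))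
    ht' ((hθ σ hσ z).2 t ht).continuousAt
    fun D hD => hθ.eventually_norm_sub_le hV hV' hI hσ' z hD).continuousWithinAt

/-- A solution of the variational equation is the spatial derivative of the flow. -/
theorem hasFDerivAt_of_variational {I : Set ℝ} (hθ : IsFlowMapOn V I θ)
    (hV : ∀ t y, HasFDerivAt (V t) (V' t y) y) (hV' : Continuous (uncurry V'))
    {α β : ℝ} (hI : Icc α β ⊆ I) {σ : ℝ} (hσ : σ ∈ Icc α β) (z : E) {Y : ℝ → E →L[ℝ] E}
    (hY0 : Y σ = .id ℝ E)
    (hY : ∀ t ∈ Icc α β, HasDerivAt Y (V' t (θ t σ z) ∘L Y t) t) {t : ℝ} (ht : t ∈ Icc α β) :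
    HasFDerivAt (θ t σ) (Y t) z := by
  have hγ := hθ.continuousOn_Icc (hI hσ) z hI
  obtain ⟨M, hM, ε, hε, hL⟩ := hθ.exists_norm_sub_le hV hV' hI (hI hσ) z
  obtain ⟨K, hK, hKb⟩ := exists_norm_le_along hV' hγ
  set X := Real.exp ((K + 1) * (β - α)) with hX
  have hX0 : 0 < X := Real.exp_pos _
  refine hasFDerivAt_iff_isLittleO.2 (Asymptotics.isLittleO_iff.2 fun c hc => ?_)
  have hη : 0 < c / (2 * M * X) := by positivity
  obtain ⟨ε', hε', hT⟩ := exists_tube_norm_sub_sub_le hV hV' hγ hη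
  have hδ : 0 < min ε (ε' / M) := by positivity
  filter_upwards [Metric.closedBall_mem_nhds z hδ] with x hx
  rw [Metric.mem_closedBall, dist_eq_norm] at hx
  rcases eq_or_ne x z with rfl | hne
  · simp
  have hd : 0 < ‖x - z‖ := norm_pos_iff.2 (sub_ne_zero.2 hne)
  have hnear := hL σ hσ x ‖x - z‖ hd (hx.trans (min_le_left _ _))
    (by rw [(hθ σ (hI hσ) z).1])
  have hMd : M * ‖x - z‖ ≤ ε' := by
    have := (le_div_iff₀ hM).1 (hx.trans (min_le_right _ _))
    linarith
  have key := norm_le_mul_exp_of_norm_deriv_le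
    (f := fun t => θ t σ x - θ t σ z - Y t (x - z))
    (f' := fun t => V t (θ t σ x) - V t (θ t σ z) - (V' t (θ t σ z) ∘L Y t) (x - z))
    (D := c / X * ‖x - z‖) (K := K) (η := c / (2 * M * X) * (M * ‖x - z‖)) (by positivity)
    (by
      have : c / (2 * M * X) * (M * ‖x - z‖) = c / X * ‖x - z‖ / 2 := by field_simp
      have : 0 < c / X * ‖x - z‖ := by positivity
      linarith)
    hK hσ
    (fun s hs => (((hθ σ (hI hσ) x).2 s (hI hs)).sub ((hθ σ (hI hσ) z).2 s (hI hs))).sub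
      ((hY s hs).clm_apply (hasDerivAt_const s (x - z)) |>.congr_deriv (by simp)))
    (by
      simp only [(hθ σ (hI hσ) x).1, (hθ σ (hI hσ) z).1, hY0, ContinuousLinearMap.id_apply,
        sub_self, norm_zero]
      positivity)
    le_rfl
    (fun s hs _ => by
      have h1 := hT s hs (θ s σ x) ((hnear s hs).trans hMd)
      have h2 : c / (2 * M * X) * ‖θ s σ x - θ s σ z‖ ≤ c / (2 * M * X) * (M * ‖x - z‖) := by
        gcongr
        exact hnear s hs
      have h3 := (V' s (θ s σ z)).le_of_opNorm_le (hKb s hs) (θ s σ x - θ s σ z - Y s (x - z))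
      have h4 : V s (θ s σ x) - V s (θ s σ z) - (V' s (θ s σ z) ∘L Y s) (x - z) =
          V' s (θ s σ z) (θ s σ x - θ s σ z - Y s (x - z)) +
          (V s (θ s σ x) - V s (θ s σ z) - V' s (θ s σ z) (θ s σ x - θ s σ z)) := by
        simp only [map_sub, ContinuousLinearMap.comp_apply]
        abel
      rw [h4]
      exact (norm_add_le _ _).trans (add_le_add h3 (h1.trans h2)))
    t ht
  refine key.trans (le_of_eq ?_)
  rw [← hX]
  field_simp

theorem fderiv_self {I : Set ℝ} (hθ : IsFlowMapOn V I θ) {σ : ℝ} (hσ : σ ∈ I) (z : E) :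
    fderiv ℝ (θ σ σ) z = .id ℝ E := by
  have : θ σ σ = id := funext fun x => (hθ σ hσ x).1
  rw [this, fderiv_id]

variable [CompleteSpace E]

theorem exists_variational_solution (hθ : IsFlowMapOn V (Ioo a b) θ)
    (hV' : Continuous (uncurry V')) {α β : ℝ} (hI : Icc α β ⊆ Ioo a b) {σ : ℝ}
    (hσ : σ ∈ Icc α β) (z : E) :
    ∃ Y : ℝ → E →L[ℝ] E, Y σ = .id ℝ E ∧
      ∀ t ∈ Icc α β, HasDerivAt Y (V' t (θ t σ z) ∘L Y t) t := by
  have hγ := hθ.continuousOn_Icc (hI hσ) z hI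
  have hαβ : α ≤ β := hσ.1.trans hσ.2
  obtain ⟨K, -, hKb⟩ := exists_norm_le_along hV' hγ
  set A : ℝ → E →L[ℝ] E := IccExtend hαβ fun t => V' t (θ t σ z) with hA
  have hAc : Continuous A := by
    refine Continuous.Icc_extend' ?_
    exact hV'.comp (continuous_subtype_val.prodMk (continuousOn_iff_continuous_domRestrict.1 hγ))
  have hAb : ∀ t, ‖ContinuousLinearMap.compL ℝ E E E (A t)‖ ≤ K := fun t =>
    (ContinuousLinearMap.opNorm_le_bound _ (norm_nonneg _) fun Z =>
      ContinuousLinearMap.opNorm_comp_le _ _).trans (hKb _ (projIcc α β hαβ t).2)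
  obtain ⟨Y, hY0, hY⟩ := exists_linearODE_solution
    ((ContinuousLinearMap.compL ℝ E E E).continuous.comp hAc) hAb σ (.id ℝ E)
  refine ⟨Y, hY0, fun t ht => ?_⟩
  have hAt : A t = V' t (θ t σ z) := IccExtend_of_mem _ _ ht
  simpa [hAt] using hY t

theorem hasFDerivAt (hθ : IsFlowMapOn V (Ioo a b) θ)
    (hV : ∀ t y, HasFDerivAt (V t) (V' t y) y) (hV' : Continuous (uncurry V'))
    {t σ : ℝ} (ht : t ∈ Ioo a b) (hσ : σ ∈ Ioo a b) (z : E) :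
    HasFDerivAt (θ t σ) (fderiv ℝ (θ t σ) z) z := by
  obtain ⟨α, β, hI, hσ', ht'⟩ := exists_Icc_subset_Ioo hσ ht
  obtain ⟨Y, hY0, hY⟩ := hθ.exists_variational_solution hV' hI (Ioo_subset_Icc_self hσ') z
  exact (hθ.hasFDerivAt_of_variational hV hV' hI (Ioo_subset_Icc_self hσ') z hY0 hY
    (Ioo_subset_Icc_self ht')).differentiableAt.hasFDerivAt

/-- The spatial derivative of the flow solves the variational equation. -/
theorem hasDerivAt_fderiv (hθ : IsFlowMapOn V (Ioo a b) θ)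
    (hV : ∀ t y, HasFDerivAt (V t) (V' t y) y) (hV' : Continuous (uncurry V'))
    {t σ : ℝ} (ht : t ∈ Ioo a b) (hσ : σ ∈ Ioo a b) (z : E) :
    HasDerivAt (fun s => fderiv ℝ (θ s σ) z)
      (V' t (θ t σ z) ∘L fderiv ℝ (θ t σ) z) t := by
  obtain ⟨α, β, hI, hσ', ht'⟩ := exists_Icc_subset_Ioo hσ ht
  obtain ⟨Y, hY0, hY⟩ := hθ.exists_variational_solution hV' hI (Ioo_subset_Icc_self hσ') z
  have heq : ∀ s ∈ Icc α β, fderiv ℝ (θ s σ) z = Y s := fun s hs =>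
    (hθ.hasFDerivAt_of_variational hV hV' hI (Ioo_subset_Icc_self hσ') z hY0 hY hs).fderiv
  rw [heq t (Ioo_subset_Icc_self ht')]
  refine (hY t (Ioo_subset_Icc_self ht')).congr_of_eventuallyEq ?_
  filter_upwards [Icc_mem_nhds ht'.1 ht'.2] with s hs using heq s hs

theorem eventually_norm_fderiv_sub_le (hθ : IsFlowMapOn V (Ioo a b) θ)
    (hV : ∀ t y, HasFDerivAt (V t) (V' t y) y) (hV' : Continuous (uncurry V'))
    {α β : ℝ} (hI : Icc α β ⊆ Ioo a b) {σ : ℝ} (hσ : σ ∈ Ioo α β) (z : E) {D : ℝ}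
    (hD : 0 < D) :
    ∀ᶠ q : ℝ × E in 𝓝 (σ, z), ∀ t ∈ Icc α β,
      ‖fderiv ℝ (θ t q.1) q.2 - fderiv ℝ (θ t σ) z‖ ≤ D := by
  have hσI := hI (Ioo_subset_Icc_self hσ)
  have hγ := hθ.continuousOn_Icc hσI z hI
  obtain ⟨K, hK, hKb⟩ := exists_norm_le_along hV' hγ
  obtain ⟨B, hB⟩ := isCompact_Icc.exists_bound_of_continuousOn (s := Icc α β)
    (f := fun s => fderiv ℝ (θ s σ) z) fun t ht =>
      (hθ.hasDerivAt_fderiv hV hV' (hI ht) hσI z).continuousAt.continuousWithinAt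
  have hB0 : 0 ≤ B := (norm_nonneg _).trans (hB σ (Ioo_subset_Icc_self hσ))
  set X := Real.exp ((K + 1 + 1) * (β - α)) with hX
  have hX0 : 0 < X := Real.exp_pos _
  have hDX : 0 < D / X := by positivity
  have hη : 0 < min 1 (D / X / (B + 1)) := by positivity
  obtain ⟨ε, hε, hT⟩ := exists_tube hV' hγ hη
  have hc : ContinuousAt (fun q : ℝ × E => ‖.id ℝ E - fderiv ℝ (θ q.1 σ) z‖) (σ, z) :=
    (continuousAt_const.sub (ContinuousAt.comp (f := Prod.fst)
      (g := fun s => fderiv ℝ (θ s σ) z)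
      (hθ.hasDerivAt_fderiv hV hV' hσI hσI z).continuousAt continuousAt_fst)).norm
  have h0 : ‖.id ℝ E - fderiv ℝ (θ σ σ) z‖ < D / X := by
    simpa [hθ.fderiv_self hσI z] using hDX
  filter_upwards [hθ.eventually_norm_sub_le hV hV' hI hσ z hε, hc.eventually_lt_const h0,
    continuousAt_fst.preimage_mem_nhds (Icc_mem_nhds hσ.1 hσ.2)] with q hq hq0 hq1 t ht
  have hηB : min 1 (D / X / (B + 1)) * B < D / X := by
    calc min 1 (D / X / (B + 1)) * B ≤ D / X / (B + 1) * B := by gcongr; exact min_le_right _ _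
      _ < D / X / (B + 1) * (B + 1) := by gcongr; linarith
      _ = D / X := by field_simp
  refine (norm_le_mul_exp_of_norm_deriv_le (r := D)
    (f := fun t => fderiv ℝ (θ t q.1) q.2 - fderiv ℝ (θ t σ) z) (K := K + 1) hDX hηB
    (by positivity) hq1
    (fun s hs => (hθ.hasDerivAt_fderiv hV hV' (hI hs) (hI hq1) q.2).sub
      (hθ.hasDerivAt_fderiv hV hV' (hI hs) hσI z))
    (by simpa only [hθ.fderiv_self (hI hq1) q.2] using hq0.le)
    (by rw [← hX]; field_simp; exact le_rfl) (fun s hs _ => ?_) t ht).trans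
      (by rw [← hX]; field_simp; exact le_rfl)
  have h1 := hT s hs _ (hq s hs)
  set A := V' s (θ s q.1 q.2)
  set A₀ := V' s (θ s σ z)
  set Y := fderiv ℝ (θ s q.1) q.2
  set Y₀ := fderiv ℝ (θ s σ) z
  have h2 : A ∘L Y - A₀ ∘L Y₀ = A ∘L (Y - Y₀) + (A - A₀) ∘L Y₀ := by
    ext v
    simp
  have hA : ‖A‖ ≤ K + 1 := by
    have := norm_le_norm_sub_add A A₀
    have := hKb s hs
    have := h1.trans (min_le_left _ _)
    linarith
  rw [h2]
  refine (norm_add_le _ _).trans (add_le_add ?_ ?_)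
  · exact (ContinuousLinearMap.opNorm_comp_le _ _).trans (by gcongr)
  · exact (ContinuousLinearMap.opNorm_comp_le _ _).trans
      (mul_le_mul h1 (hB s hs) (norm_nonneg _) hη.le)

theorem continuousOn_fderiv (hθ : IsFlowMapOn V (Ioo a b) θ)
    (hV : ∀ t y, HasFDerivAt (V t) (V' t y) y) (hV' : Continuous (uncurry V')) :
    ContinuousOn (uncurry fun t (q : ℝ × E) => fderiv ℝ (θ t q.1) q.2)
      (Ioo a b ×ˢ Ioo a b ×ˢ univ) := by
  rintro ⟨t, σ, z⟩ ⟨ht, hσ, -⟩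
  obtain ⟨α, β, hI, hσ', ht'⟩ := exists_Icc_subset_Ioo hσ ht
  exact (continuousAt_uncurry_of_forall_Icc
    (g := fun t (q : ℝ × E) => fderiv ℝ (θ t q.1) q.2) (q := (σ, z)) ht'
    (hθ.hasDerivAt_fderiv hV hV' ht hσ z).continuousAt
    fun D hD => hθ.eventually_norm_fderiv_sub_le hV hV' hI hσ' z hD).continuousWithinAt

/-- The flow together with its spatial derivative is the flow of the variational system. -/
theorem variational (hθ : IsFlowMapOn V (Ioo a b) θ)
    (hV : ∀ t y, HasFDerivAt (V t) (V' t y) y) (hV' : Continuous (uncurry V')) :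
    IsFlowMapOn (E := E × (E →L[ℝ] E)) (fun t w => (V t w.1, V' t w.1 ∘L w.2)) (Ioo a b)
      fun t σ w => (θ t σ w.1, fderiv ℝ (θ t σ) w.1 ∘L w.2) := by
  refine fun σ hσ w => ⟨?_, fun t ht => ?_⟩
  · simp [hθ.fderiv_self hσ, (hθ σ hσ w.1).1]
  · refine ((hθ σ hσ w.1).2 t ht).prodMk ?_
    have := (hθ.hasDerivAt_fderiv hV hV' ht hσ w.1).clm_comp (hasDerivAt_const t w.2)
    simpa [ContinuousLinearMap.comp_assoc] using this

end IsFlowMapOn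

end Flow

/-- The flow of a `C^(k+1)` time-dependent vector field is `C^(k+1)` in the initial point, with
derivatives jointly continuous in the final time, the initial time and the initial point. -/
theorem ParamContDiff.flowMap {E : Type u} [NormedAddCommGroup E] [NormedSpace ℝ E]
    [CompleteSpace E] {V : ℝ → E → E} {a b : ℝ} {θ : ℝ → ℝ → E → E} {k : ℕ}
    (hV : ParamContDiff univ (k + 1) V) (hθ : IsFlowMapOn V (Ioo a b) θ) :
    ParamContDiff (Ioo a b ×ˢ Ioo a b) (k + 1) fun p : ℝ × ℝ => θ p.1 p.2 := by
  have hd : ∀ t y, HasFDerivAt (V t) (fderiv ℝ (V t) y) y := fun t => hV.hasFDerivAt (mem_univ t)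
  have hd' : Continuous (uncurry fun t => fderiv ℝ (V t)) := by
    simpa [continuousOn_univ] using hV.2.2.continuousOn
  have hassoc : ∀ {F : Type u} [NormedAddCommGroup F] {g : ℝ → ℝ → E → F},
      ContinuousOn (uncurry fun t (q : ℝ × E) => g t q.1 q.2) (Ioo a b ×ˢ Ioo a b ×ˢ univ) →
      ContinuousOn (uncurry fun p : ℝ × ℝ => g p.1 p.2) ((Ioo a b ×ˢ Ioo a b) ×ˢ univ) :=
    fun hg => hg.comp (f := fun q : (ℝ × ℝ) × E => (q.1.1, q.1.2, q.2)) (by fun_prop)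
      fun q hq => ⟨hq.1.1, hq.1.2, trivial⟩
  refine succ_of_hasFDerivAt (hassoc (hθ.continuousOn_uncurry hd hd'))
    (fun p hp x => hθ.hasFDerivAt hd hd' hp.1 hp.2 x) ?_
  cases k with
  | zero => exact hassoc (g := fun t σ x => fderiv ℝ (θ t σ) x) (hθ.continuousOn_fderiv hd hd')
  | succ k =>
    have hW : ParamContDiff univ (k + 1) fun (t : ℝ) (w : E × (E →L[ℝ] E)) =>
        (V t w.1, fderiv ℝ (V t) w.1 ∘L w.2) := by
      refine (hV.of_succ.comp_affine fun w => hasFDerivAt_fst).prodMk ?_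
      refine bilinear (ContinuousLinearMap.compL ℝ E E E)
        (hV.2.2.comp_affine fun w => hasFDerivAt_fst) ?_
      exact clm (.snd ℝ E (E →L[ℝ] E))
    refine ((hW.flowMap (hθ.variational hd hd')).comp_affine
      (a := fun x : E => (x, ContinuousLinearMap.id ℝ E))
      fun x => (hasFDerivAt_id x).prodMk (hasFDerivAt_const _ x)).clm_comp
        (.snd ℝ E (E →L[ℝ] E)) |>.congr fun p hp => ?_
    ext x : 1
    simp

/-- **Existence and joint continuity of the spatial derivatives of the flow.**
Let `V : ℝ × ℝⁿ → ℝⁿ` be continuous and bounded, uniformly Lipschitz in the second variable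
with constant `C > 0`. Let `k ≥ 1` and assume for each `1 ≤ j ≤ k` and every `τ` the `j`-th
Fréchet derivative of `y ↦ V (τ, y)` exists and `(τ, y) ↦ D_y^j V (τ, y)` is continuous on
`ℝ × ℝⁿ`. Let `I₀ = Ioo a b` be an open interval of length less than `1/C`. Then for any
local flow map `θ` for `V` on `I₀` and each `1 ≤ j ≤ k`, the `j`-th iterated Fréchet
derivative of `θ` with respect to the third variable exists everywhere (the map
`x ↦ θ τ τ₀ x` is `Cʲ` for each `τ, τ₀ ∈ I₀`) and `(τ, τ₀, x) ↦ D_x^j θ (τ, τ₀, x)` is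
continuous on `I₀ × I₀ × ℝⁿ`. -/
theorem stmt_5 {n : ℕ} (hn : 1 ≤ n)
    (V : ℝ × EuclideanSpace ℝ (Fin n) → EuclideanSpace ℝ (Fin n))
    (C : ℝ) (hC : 0 < C)
    (hVcont : Continuous V)
    (hVbdd : ∃ M : ℝ, ∀ p, ‖V p‖ ≤ M)
    (hVlip : ∀ (τ : ℝ) (y₁ y₂ : EuclideanSpace ℝ (Fin n)),
      ‖V (τ, y₁) - V (τ, y₂)‖ ≤ C * ‖y₁ - y₂‖)
    (k : ℕ) (hk : 1 ≤ k)
    (hVk : ∀ τ : ℝ, ContDiff ℝ (k : ℕ∞) (fun y => V (τ, y)))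
    (hDVcont : ∀ j : ℕ, 1 ≤ j → j ≤ k →
      Continuous (fun p : ℝ × EuclideanSpace ℝ (Fin n) =>
        iteratedFDeriv ℝ j (fun y => V (p.1, y)) p.2))
    (a b : ℝ) (hab : a < b) (hlen : b - a < 1 / C)
    (θ : ℝ → ℝ → EuclideanSpace ℝ (Fin n) → EuclideanSpace ℝ (Fin n))
    (hθ : IsLocalFlowMap V (Set.Ioo a b) θ) :
    ∀ j : ℕ, 1 ≤ j → j ≤ k →
      (∀ τ ∈ Set.Ioo a b, ∀ τ₀ ∈ Set.Ioo a b,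
        ContDiff ℝ (j : ℕ∞) (fun x : EuclideanSpace ℝ (Fin n) => θ τ τ₀ x)) ∧
      ContinuousOn
        (fun p : ℝ × ℝ × EuclideanSpace ℝ (Fin n) =>
          iteratedFDeriv ℝ j (fun x => θ p.1 p.2.1 x) p.2.2)
        (Set.Ioo a b ×ˢ Set.Ioo a b ×ˢ (Set.univ : Set (EuclideanSpace ℝ (Fin n)))) := by
  have hV : ParamContDiff univ k fun τ y => V (τ, y) := by
    refine .of_continuousOn_iteratedFDeriv (fun τ _ => hVk τ) fun j hj => ?_
    rw [univ_prod_univ, continuousOn_univ]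
    rcases j.eq_zero_or_pos with rfl | hj0
    · simp only [iteratedFDeriv_zero_eq_comp]
      exact (continuousMultilinearCurryFin0 ℝ _ _).symm.continuous.comp hVcont
    · exact hDVcont j hj0 hj
  obtain ⟨k, rfl⟩ := Nat.exists_eq_add_of_le' hk
  have h := hV.flowMap hθ
  refine fun j _ hj => ⟨fun τ hτ τ₀ hτ₀ => ?_, ?_⟩
  · exact (h.contDiff (p := (τ, τ₀)) ⟨hτ, hτ₀⟩).of_le (mod_cast hj)
  · exact (h.continuousOn_iteratedFDeriv hj).comp
      (f := fun p : ℝ × ℝ × EuclideanSpace ℝ (Fin n) => ((p.1, p.2.1), p.2.2)) (by fun_prop)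
      fun p hp => ⟨⟨hp.1, hp.2.1⟩, trivial⟩
end
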